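/- Let (𝒫, 𝒩) be a Beurling generalized number system with θ-well-behaved integers (N(x) = Ax + O(x^θ), A > 0, θ ∈ [0,1)) that moreover satisfies the average Ramanujan condition: there exists p > 1 such that for every ε > 0, ∑_{n_k ≤ x} χ(n_k, 1)^p ≪_ε x^{1+ε}. Then for every ε > 0 and δ > 0 there exists T_0 = T_0(ε, δ) such that uniformly for T ≥ T_0 and α ≥ (θ+2)/3 + δ: N(α, T) ≪_{ε,p} T^{ ((1−α)(4α − 2θ))/(2α² − 3α + 2 − θ) + ε }. -/

import Mathlib

open Filter Topology

/-- A Beurling generalized prime number system: a nondecreasing sequence of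
generalized primes, each `> 1`, tending to infinity. -/
structure BeurlingSystem where
  p : ℕ → ℝ
  one_lt_p : ∀ k, 1 < p k
  p_mono : Monotone p
  p_tendsto : Filter.Tendsto p Filter.atTop Filter.atTop

namespace BeurlingSystem

variable (S : BeurlingSystem)

/-- The numerical value of a generalized integer, encoded as the finitely supported
vector of exponents of the generalized primes. -/
noncomputable def val (n : ℕ →₀ ℕ) : ℝ := n.prod fun k e => S.p k ^ e

/-- The integer counting function `N(x)`. -/
noncomputable def cnt (x : ℝ) : ℝ := (Set.ncard {n : ℕ →₀ ℕ | S.val n ≤ x} : ℝ)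

/-- `χ(x, λ)`: the number of generalized integers within distance `λ` of `x`. -/
noncomputable def chi (x lam : ℝ) : ℝ := (Set.ncard {n : ℕ →₀ ℕ | |x - S.val n| ≤ lam} : ℝ)

/-- The integers are `θ`-well-behaved with density `A` and implied constant `K₀`:
`N(x) = A x + O(x^θ)`. -/
def WellBehaved (A θ K₀ : ℝ) : Prop :=
  0 < A ∧ 0 ≤ θ ∧ θ < 1 ∧ 0 ≤ K₀ ∧ ∀ x : ℝ, 1 ≤ x → |S.cnt x - A * x| ≤ K₀ * x ^ θ

/-- `ζ` is (the unique) analytic continuation of the Beurling zeta function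
to `{Re s > θ} \ {1}`. -/
def IsZeta (θ : ℝ) (ζ : ℂ → ℂ) : Prop :=
  DifferentiableOn ℂ ζ {s : ℂ | θ < s.re ∧ s ≠ 1} ∧
  ∀ s : ℂ, 1 < s.re → ζ s = ∑' n : ℕ →₀ ℕ, (S.val n : ℂ) ^ (-s)

/-- The von Mangoldt function: `log p` on prime powers `p^m`, `0` otherwise. -/
noncomputable def vonMangoldt (n : ℕ →₀ ℕ) : ℝ :=
  ∑ k ∈ n.support, if n.support = {k} then Real.log (S.p k) else 0

/-- The Chebyshev function `ψ(x)`. -/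
noncomputable def psi (x : ℝ) : ℝ :=
  ∑ᶠ n ∈ {n : ℕ →₀ ℕ | S.val n ≤ x}, S.vonMangoldt n

end BeurlingSystem

/-- The generalized divisor function: the number of ordered pairs of generalized
integers whose formal product equals `n`. -/
noncomputable def gDivisor (n : ℕ →₀ ℕ) : ℝ :=
  (Set.ncard {q : (ℕ →₀ ℕ) × (ℕ →₀ ℕ) | q.1 + q.2 = n} : ℝ)

/-- The generalized Möbius function. -/
noncomputable def gMoebius (n : ℕ →₀ ℕ) : ℝ :=
  if ∀ k ∈ n.support, n k ≤ 1 then (-1 : ℝ) ^ n.support.card else 0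

/-- The zero-counting function `N(α, T)` of the (continued) zeta function. -/
noncomputable def zeroCount (ζ : ℂ → ℂ) (α T : ℝ) : ℝ :=
  (Set.ncard {ρ : ℂ | ζ ρ = 0 ∧ ρ ≠ 1 ∧ α ≤ ρ.re ∧ |ρ.im| ≤ T} : ℝ)

namespace BeurlingSystem

variable (S : BeurlingSystem)

lemma val_zero : S.val 0 = 1 := by simp [val]

lemma val_add (m n : ℕ →₀ ℕ) : S.val (m + n) = S.val m * S.val n :=
  Finsupp.prod_add_index' (by simp) (by intro k a b; exact pow_add _ _ _)

lemma one_le_val (n : ℕ →₀ ℕ) : 1 ≤ S.val n :=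
  Finset.prod_induction _ (fun x : ℝ => 1 ≤ x) (fun _ _ => one_le_mul_of_one_le_of_one_le) le_rfl
    fun k _ => one_le_pow₀ (S.one_lt_p k).le

lemma val_pos (n : ℕ →₀ ℕ) : 0 < S.val n := zero_lt_one.trans_le (S.one_le_val n)

lemma val_single (k e : ℕ) : S.val (Finsupp.single k e) = S.p k ^ e := by
  simp [val]

lemma pow_le_val (n : ℕ →₀ ℕ) (k : ℕ) : S.p k ^ n k ≤ S.val n := by
  have h : S.val n = S.p k ^ n k * S.val (n.erase k) := by
    rw [← S.val_single, ← S.val_add, Finsupp.single_add_erase]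
  rw [h]
  exact le_mul_of_one_le_right (pow_nonneg (zero_lt_one.trans (S.one_lt_p k)).le _)
    (S.one_le_val _)

lemma p_zero_le_val {n : ℕ →₀ ℕ} (hn : n ≠ 0) : S.p 0 ≤ S.val n := by
  obtain ⟨k, hk⟩ := Finsupp.ne_iff.mp hn
  have h1 : S.p k ≤ S.p k ^ n k := le_self_pow₀ (S.one_lt_p k).le (by simpa using hk)
  exact (S.p_mono (Nat.zero_le k)).trans (h1.trans (S.pow_le_val n k))

lemma finite_val_le (x : ℝ) : {n : ℕ →₀ ℕ | S.val n ≤ x}.Finite := by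
  obtain ⟨K, hK⟩ := (S.p_tendsto.eventually_gt_atTop x).exists
  obtain ⟨B, hB⟩ := pow_unbounded_of_one_lt x (S.one_lt_p 0)
  refine (Set.finite_Iic (Finsupp.indicator (Finset.range K) fun _ _ => B)).subset ?_
  intro n hn
  have hn' : S.val n ≤ x := hn
  intro k
  by_cases hk : k < K
  · rw [Finsupp.indicator_apply, dif_pos (Finset.mem_range.mpr hk)]
    by_contra! hlt
    have h1 : S.p 0 ^ B ≤ S.p 0 ^ n k := pow_le_pow_right₀ (S.one_lt_p 0).le hlt.le
    have h2 : S.p 0 ^ n k ≤ S.p k ^ n k :=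
      pow_le_pow_left₀ (zero_lt_one.trans (S.one_lt_p 0)).le (S.p_mono (Nat.zero_le k)) _
    linarith [S.pow_le_val n k]
  · rw [Finsupp.indicator_apply, dif_neg (by simpa using hk)]
    by_contra! hlt
    have h1 : S.p k ≤ S.p k ^ n k := le_self_pow₀ (S.one_lt_p k).le hlt.ne'
    have h2 : S.p K ≤ S.p k := S.p_mono (not_lt.mp hk)
    linarith [S.pow_le_val n k]

/-- The finset of generalized integers of value at most `x`. -/
noncomputable def upTo (x : ℝ) : Finset (ℕ →₀ ℕ) := (S.finite_val_le x).toFinset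

@[simp] lemma mem_upTo {x : ℝ} {n : ℕ →₀ ℕ} : n ∈ S.upTo x ↔ S.val n ≤ x := by
  simp [upTo]

lemma cnt_eq_card (x : ℝ) : S.cnt x = (S.upTo x).card := by
  rw [cnt, Set.ncard_eq_toFinset_card _ (S.finite_val_le x)]; rfl

lemma cnt_mono : Monotone S.cnt := by
  intro x y h
  rw [cnt_eq_card, cnt_eq_card]
  exact_mod_cast Finset.card_le_card fun n hn => by
    rw [mem_upTo] at *; exact hn.trans h

lemma upTo_one : S.upTo 1 = {0} := by
  ext n
  rw [mem_upTo, Finset.mem_singleton]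
  constructor
  · intro h
    by_contra hn
    linarith [S.p_zero_le_val hn, S.one_lt_p 0]
  · rintro rfl
    rw [val_zero]

variable {S} {A θ K₀ : ℝ}

lemma WellBehaved.cnt_le (h : S.WellBehaved A θ K₀) {x : ℝ} (hx : 1 ≤ x) :
    S.cnt x ≤ (A + K₀) * x := by
  obtain ⟨hA, h0, h1, hK, hE⟩ := h
  have h2 : x ^ θ ≤ x := by
    simpa using Real.rpow_le_rpow_of_exponent_le hx h1.le
  have h3 := (abs_le.mp (hE x hx)).2
  nlinarith [mul_le_mul_of_nonneg_left h2 hK]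

lemma WellBehaved.summable (h : S.WellBehaved A θ K₀) {σ : ℝ} (hσ : 1 < σ) :
    Summable fun n => S.val n ^ (-σ) := by
  classical
  have hAK : 0 ≤ A + K₀ := by have := h.1; have := h.2.2.2.1; linarith
  set q : ℝ := 2 ^ (1 - σ) with hq
  have hq0 : 0 < q := by positivity
  have hq1 : q < 1 := Real.rpow_lt_one_of_one_lt_of_neg one_lt_two (by linarith)
  refine summable_of_sum_le (c := 2 * (A + K₀) * (1 - q)⁻¹)
    (fun n => Real.rpow_nonneg (S.val_pos n).le _) fun s => ?_
  set κ : (ℕ →₀ ℕ) → ℕ := fun n => Nat.log 2 ⌊S.val n⌋₊ with hκ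
  have hκ1 : ∀ n, (2 : ℝ) ^ κ n ≤ S.val n := fun n => by
    have h1 : 2 ^ κ n ≤ ⌊S.val n⌋₊ :=
      Nat.pow_log_le_self 2 (Nat.floor_pos.mpr (S.one_le_val n)).ne'
    calc (2 : ℝ) ^ κ n = ((2 ^ κ n : ℕ) : ℝ) := by push_cast; rfl
      _ ≤ ⌊S.val n⌋₊ := by exact_mod_cast h1
      _ ≤ S.val n := Nat.floor_le (S.val_pos n).le
  have hκ2 : ∀ n, S.val n ≤ (2 : ℝ) ^ (κ n + 1) := fun n => by
    have h1 : ⌊S.val n⌋₊ < 2 ^ (κ n + 1) := Nat.lt_pow_succ_log_self one_lt_two _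
    have h2 : ((⌊S.val n⌋₊ : ℕ) : ℝ) + 1 ≤ ((2 ^ (κ n + 1) : ℕ) : ℝ) := by exact_mod_cast h1
    push_cast at h2
    linarith [Nat.lt_floor_add_one (S.val n)]
  calc ∑ n ∈ s, S.val n ^ (-σ)
      = ∑ k ∈ s.image κ, ∑ n ∈ s with κ n = k, S.val n ^ (-σ) :=
        (Finset.sum_fiberwise_of_maps_to (fun n hn => Finset.mem_image_of_mem _ hn) _).symm
    _ ≤ ∑ k ∈ s.image κ, 2 * (A + K₀) * q ^ k := by
        refine Finset.sum_le_sum fun k _ => ?_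
        have h1 : ∀ n ∈ s.filter (fun n => κ n = k), S.val n ^ (-σ) ≤ ((2 : ℝ) ^ k) ^ (-σ) := by
          intro n hn
          rw [Finset.mem_filter] at hn
          exact Real.rpow_le_rpow_of_nonpos (by positivity) (hn.2 ▸ hκ1 n) (by linarith)
        have h2 : ((s.filter (fun n => κ n = k)).card : ℝ) ≤ (A + K₀) * 2 ^ (k + 1) := by
          refine le_trans ?_ (h.cnt_le (one_le_pow₀ one_le_two))
          rw [cnt_eq_card]
          exact_mod_cast Finset.card_le_card fun n hn => by
            rw [Finset.mem_filter] at hn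
            rw [mem_upTo]
            push_cast
            exact hn.2 ▸ hκ2 n
        refine (Finset.sum_le_card_nsmul _ _ _ h1).trans ?_
        rw [nsmul_eq_mul]
        refine (mul_le_mul_of_nonneg_right h2 (by positivity)).trans_eq ?_
        have h3 : q ^ k = 2 ^ k * ((2 : ℝ) ^ k) ^ (-σ) := by
          rw [hq, ← Real.rpow_natCast, ← Real.rpow_mul two_pos.le, ← Real.rpow_natCast 2 k,
            ← Real.rpow_mul two_pos.le, ← Real.rpow_add two_pos]
          congr 1; ring
        rw [h3]; ring
    _ = 2 * (A + K₀) * ∑ k ∈ s.image κ, q ^ k := by rw [Finset.mul_sum]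
    _ ≤ 2 * (A + K₀) * (1 - q)⁻¹ := by
        refine mul_le_mul_of_nonneg_left ?_ (by positivity)
        rw [← tsum_geometric_of_lt_one hq0.le hq1]
        exact (summable_geometric_of_lt_one hq0.le hq1).sum_le_tsum _ fun _ _ => by positivity

lemma norm_val_cpow (n : ℕ →₀ ℕ) (s : ℂ) : ‖(S.val n : ℂ) ^ (-s)‖ = S.val n ^ (-s.re) := by
  rw [Complex.norm_cpow_eq_rpow_re_of_pos (S.val_pos n), Complex.neg_re]

lemma WellBehaved.summable_norm_cpow (h : S.WellBehaved A θ K₀) {s : ℂ} (hs : 1 < s.re) :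
    Summable fun n => ‖(S.val n : ℂ) ^ (-s)‖ := by
  simp only [norm_val_cpow]
  exact h.summable hs

lemma val_add_cpow (m n : ℕ →₀ ℕ) (s : ℂ) :
    (S.val (m + n) : ℂ) ^ s = (S.val m : ℂ) ^ s * (S.val n : ℂ) ^ s := by
  rw [val_add, Complex.ofReal_mul, Complex.mul_cpow_ofReal_nonneg (S.val_pos m).le (S.val_pos n).le]

end BeurlingSystem

lemma gMoebius_eq_prod (n : ℕ →₀ ℕ) :
    gMoebius n = n.prod fun _ e => if e = 0 then 1 else if e = 1 then (-1 : ℝ) else 0 := by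
  rw [gMoebius, Finsupp.prod]
  split_ifs with h
  · rw [← Finset.prod_const]
    refine Finset.prod_congr rfl fun k hk => ?_
    have h1 := h k hk
    have h2 : n k ≠ 0 := Finsupp.mem_support_iff.mp hk
    rw [if_neg h2, if_pos (by omega)]
  · push Not at h
    obtain ⟨k, hk, h1⟩ := h
    exact (Finset.prod_eq_zero hk (by rw [if_neg (by omega), if_neg (by omega)])).symm

lemma gMoebius_eq_mul_erase (n : ℕ →₀ ℕ) (k : ℕ) :
    gMoebius n = (if n k = 0 then 1 else if n k = 1 then (-1 : ℝ) else 0) *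
      gMoebius (n.erase k) := by
  rw [gMoebius_eq_prod, gMoebius_eq_prod,
    ← Finsupp.mul_prod_erase' n k (fun _ e => if e = 0 then 1 else if e = 1 then (-1 : ℝ) else 0)
      (fun _ => by simp)]

lemma abs_gMoebius_le (n : ℕ →₀ ℕ) : |gMoebius n| ≤ 1 := by
  rw [gMoebius]
  split_ifs <;> simp [abs_pow]

lemma gMoebius_zero : gMoebius 0 = 1 := by simp [gMoebius]

lemma sum_gMoebius_antidiagonal {n : ℕ →₀ ℕ} (hn : n ≠ 0) :
    ∑ q ∈ Finset.HasAntidiagonal.antidiagonal n, gMoebius q.1 = 0 := by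
  classical
  obtain ⟨k, hk⟩ := Finsupp.ne_iff.mp hn
  have hk' : 1 ≤ n k := Nat.one_le_iff_ne_zero.mpr (by simpa using hk)
  set φ : ℕ → ℕ := fun e => if e = 0 then 1 else if e = 1 then 0 else e with hφ
  set τ : (ℕ →₀ ℕ) → (ℕ →₀ ℕ) := fun d => d.update k (φ (d k)) with hτ
  have hφφ : ∀ e, φ (φ e) = e := by
    intro e; rcases e with _ | _ | e <;> simp [hφ]
  have hττ : ∀ d, τ (τ d) = d := by
    intro d
    ext j
    by_cases hj : j = k
    · subst hj; simp [hτ, hφφ]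
    · simp [hτ, Function.update_of_ne hj]
  have herase : ∀ d, (τ d).erase k = d.erase k := by
    intro d
    ext j
    by_cases hj : j = k
    · subst hj; simp
    · simp [hτ, Finsupp.erase_ne hj]
  have hτk : ∀ d, τ d k = φ (d k) := by intro d; simp [hτ]
  have hle : ∀ d, d ≤ n → τ d ≤ n := by
    intro d hd j
    by_cases hj : j = k
    · subst hj
      rw [hτk]
      have := hd j
      simp only [hφ]
      split_ifs <;> omega
    · simpa [hτ, Function.update_of_ne hj] using hd j
  refine Finset.sum_involution (fun q _ => (τ q.1, n - τ q.1)) ?_ ?_ ?_ ?_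
  · intro q _
    rw [gMoebius_eq_mul_erase q.1 k, gMoebius_eq_mul_erase (τ q.1) k, herase, hτk]
    generalize q.1 k = e
    rcases e with _ | _ | e <;> simp [hφ]
  · intro q _ h1 h2
    have h3 : τ q.1 k = q.1 k := DFunLike.congr_fun (congrArg Prod.fst h2) k
    rw [hτk] at h3
    apply h1
    rw [gMoebius_eq_mul_erase q.1 k]
    generalize q.1 k = e at h3
    rcases e with _ | _ | e <;> simp [hφ] at h3 ⊢
  · intro q hq
    rw [Finset.HasAntidiagonal.mem_antidiagonal] at hq ⊢
    exact add_tsub_cancel_of_le (hle _ (hq ▸ le_self_add))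
  · intro q hq
    rw [Finset.HasAntidiagonal.mem_antidiagonal] at hq
    refine Prod.ext (hττ _) ?_
    simp only [hττ]
    rw [← hq, add_tsub_cancel_left]

lemma tsum_mul_tsum_finsupp {f g : (ℕ →₀ ℕ) → ℂ} (hf : Summable fun n => ‖f n‖)
    (hg : Summable fun n => ‖g n‖) :
    (∑' n, f n) * ∑' n, g n =
      ∑' n, ∑ q ∈ Finset.HasAntidiagonal.antidiagonal n, f q.1 * g q.2 :=
  hf.of_norm.tsum_mul_tsum_eq_tsum_sum_antidiagonal (A := ℕ →₀ ℕ) hg.of_norm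
    (summable_mul_of_summable_norm hf hg)

namespace BeurlingSystem

open MeasureTheory

variable {S : BeurlingSystem} {A θ K₀ : ℝ} {ζ : ℂ → ℂ}

lemma IsZeta.ne_zero (hζ : S.IsZeta θ ζ) (h : S.WellBehaved A θ K₀) {s : ℂ} (hs : 1 < s.re) :
    ζ s ≠ 0 := by
  have h1 := h.summable_norm_cpow hs
  have h2 : Summable fun n => ‖(gMoebius n : ℂ) * (S.val n : ℂ) ^ (-s)‖ := by
    refine h1.of_nonneg_of_le (fun _ => norm_nonneg _) fun n => ?_
    rw [norm_mul, Complex.norm_real]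
    exact mul_le_of_le_one_left (norm_nonneg _) (abs_gMoebius_le n)
  have h3 := tsum_mul_tsum_finsupp h2 h1
  have h4 : ∀ n : ℕ →₀ ℕ, ∑ q ∈ Finset.HasAntidiagonal.antidiagonal n,
      (gMoebius q.1 : ℂ) * (S.val q.1 : ℂ) ^ (-s) * (S.val q.2 : ℂ) ^ (-s) =
      if n = 0 then 1 else 0 := by
    intro n
    have h5 : ∀ q ∈ Finset.HasAntidiagonal.antidiagonal n,
        (gMoebius q.1 : ℂ) * (S.val q.1 : ℂ) ^ (-s) * (S.val q.2 : ℂ) ^ (-s) =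
        (gMoebius q.1 : ℂ) * (S.val n : ℂ) ^ (-s) := by
      intro q hq
      rw [← Finset.HasAntidiagonal.mem_antidiagonal.mp hq, val_add_cpow, mul_assoc]
    rw [Finset.sum_congr rfl h5, ← Finset.sum_mul]
    split_ifs with hn
    · subst hn
      simp [gMoebius_zero, val_zero]
    · rw [← Complex.ofReal_sum, sum_gMoebius_antidiagonal hn]; simp
  simp only [h4, tsum_ite_eq] at h3
  intro h0
  rw [hζ.2 s hs] at h0
  rw [h0, mul_zero] at h3
  exact zero_ne_one h3

/-- The remainder in the counting function of the generalized integers. -/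
noncomputable def remainder (S : BeurlingSystem) (A x : ℝ) : ℝ := S.cnt x - A * x

lemma WellBehaved.abs_remainder_le (h : S.WellBehaved A θ K₀) {x : ℝ} (hx : 1 ≤ x) :
    |S.remainder A x| ≤ K₀ * x ^ θ := h.2.2.2.2 x hx

lemma measurable_remainder : Measurable (S.remainder A) :=
  S.cnt_mono.measurable.sub (measurable_const.mul measurable_id)

/-- The tail of the Mellin transform of the remainder. -/
noncomputable def tail (S : BeurlingSystem) (A Z : ℝ) (s : ℂ) : ℂ :=
  ∫ u in Set.Ioi Z, (S.remainder A u : ℂ) * (u : ℂ) ^ (-s - 1)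

lemma WellBehaved.norm_remainder_mul_le (h : S.WellBehaved A θ K₀) {u : ℝ} (hu : 1 ≤ u) (s : ℂ) :
    ‖(S.remainder A u : ℂ) * (u : ℂ) ^ (-s - 1)‖ ≤ K₀ * u ^ (θ - s.re - 1) := by
  have hu0 : 0 < u := zero_lt_one.trans_le hu
  rw [norm_mul, Complex.norm_real, Complex.norm_cpow_eq_rpow_re_of_pos hu0, Real.norm_eq_abs,
    show θ - s.re - 1 = θ + (-s - 1).re by simp; ring, Real.rpow_add hu0, ← mul_assoc]
  exact mul_le_mul_of_nonneg_right (h.abs_remainder_le hu) (Real.rpow_nonneg hu0.le _)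

lemma measurable_cpow_ofReal (s : ℂ) : Measurable fun u : ℝ => (u : ℂ) ^ s :=
  Complex.measurable_ofReal.pow_const s

lemma WellBehaved.integrableOn_remainder (h : S.WellBehaved A θ K₀) {Z : ℝ} (hZ : 1 ≤ Z) {s : ℂ}
    (hs : θ < s.re) : IntegrableOn
      (fun u : ℝ => (S.remainder A u : ℂ) * (u : ℂ) ^ (-s - 1)) (Set.Ioi Z) := by
  have h1 : IntegrableOn (fun u : ℝ => K₀ * u ^ (θ - s.re - 1)) (Set.Ioi Z) :=
    (integrableOn_Ioi_rpow_of_lt (by linarith) (by linarith)).const_mul _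
  refine h1.mono' ?_ ?_
  · exact ((Complex.measurable_ofReal.comp measurable_remainder).mul
      (measurable_cpow_ofReal _)).aestronglyMeasurable
  · refine (ae_restrict_iff' measurableSet_Ioi).mpr (ae_of_all _ fun u hu => ?_)
    exact h.norm_remainder_mul_le (hZ.trans (le_of_lt hu)) s

lemma WellBehaved.norm_tail_le (h : S.WellBehaved A θ K₀) {Z : ℝ} (hZ : 1 ≤ Z) {s : ℂ}
    (hs : θ < s.re) : ‖S.tail A Z s‖ ≤ K₀ * Z ^ (θ - s.re) / (s.re - θ) := by
  have hZ0 : 0 < Z := by linarith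
  have h1 : IntegrableOn (fun u : ℝ => K₀ * u ^ (θ - s.re - 1)) (Set.Ioi Z) :=
    (integrableOn_Ioi_rpow_of_lt (by linarith) hZ0).const_mul _
  calc ‖S.tail A Z s‖ ≤ ∫ u in Set.Ioi Z, K₀ * u ^ (θ - s.re - 1) := by
        refine norm_integral_le_of_norm_le h1 ?_
        refine (ae_restrict_iff' measurableSet_Ioi).mpr (ae_of_all _ fun u hu => ?_)
        exact h.norm_remainder_mul_le (hZ.trans (le_of_lt hu)) s
    _ = K₀ * Z ^ (θ - s.re) / (s.re - θ) := by
        rw [integral_const_mul, integral_Ioi_rpow_of_lt (by linarith) hZ0,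
          sub_add_cancel, ← neg_sub s.re θ, neg_div_neg_eq, mul_div_assoc]

lemma WellBehaved.differentiableAt_tail (h : S.WellBehaved A θ K₀) {Z : ℝ} (hZ : 1 ≤ Z) {s : ℂ}
    (hs : θ < s.re) : DifferentiableAt ℂ (S.tail A Z) s := by
  set f : ℝ → ℂ := (Set.Ioi Z).indicator fun u => (S.remainder A u : ℂ) with hf
  have hZ0 : 0 < Z := by linarith
  have hE : Measurable fun u : ℝ => (S.remainder A u : ℂ) :=
    Complex.measurable_ofReal.comp measurable_remainder
  have hfm : Measurable f := hE.indicator measurableSet_Ioi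
  have h1 : S.tail A Z = fun s => mellin f (-s) := by
    ext s
    rw [tail, mellin]
    have h2 : ∀ t : ℝ, (t : ℂ) ^ (-s - 1) • f t =
        (Set.Ioi Z).indicator (fun u : ℝ => (S.remainder A u : ℂ) * (u : ℂ) ^ (-s - 1)) t := by
      intro t
      by_cases ht : t ∈ Set.Ioi Z
      · rw [hf, Set.indicator_of_mem ht, Set.indicator_of_mem ht, smul_eq_mul, mul_comm]
      · rw [hf, Set.indicator_of_notMem ht, Set.indicator_of_notMem ht, smul_zero]
    simp only [h2]
    rw [setIntegral_indicator measurableSet_Ioi,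
      Set.inter_eq_self_of_subset_right (Set.Ioi_subset_Ioi hZ0.le)]
  have hbound : ∀ u, 1 ≤ u → ‖f u‖ ≤ K₀ * u ^ θ := by
    intro u hu
    by_cases ht : u ∈ Set.Ioi Z
    · rw [hf, Set.indicator_of_mem ht, Complex.norm_real]
      exact h.abs_remainder_le hu
    · rw [hf, Set.indicator_of_notMem ht, norm_zero]
      have := h.2.2.2.1
      positivity
  have hloc : LocallyIntegrableOn f (Set.Ioi 0) := by
    refine LocallyIntegrable.locallyIntegrableOn ?_ _
    intro x
    set y := max x 1 + 1
    have hy : 1 ≤ y := by simp only [y]; linarith [le_max_right x 1]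
    refine ⟨Set.Iio y, Iio_mem_nhds (by simp only [y]; linarith [le_max_left x 1]), ?_⟩
    have h3 : IntegrableOn
        ((Set.Ioo Z y).indicator fun _ : ℝ => K₀ * y ^ θ) (Set.Iio y) := by
      refine Integrable.integrableOn ?_
      rw [integrable_indicator_iff measurableSet_Ioo]
      exact integrableOn_const (by simp) ENNReal.coe_ne_top
    refine h3.mono' hfm.aestronglyMeasurable ?_
    refine (ae_restrict_iff' measurableSet_Iio).mpr (ae_of_all _ fun u hu => ?_)
    by_cases ht : u ∈ Set.Ioi Z
    · rw [Set.indicator_of_mem (show u ∈ Set.Ioo Z y from ⟨ht, hu⟩)]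
      have hu1 : 1 ≤ u := hZ.trans (le_of_lt ht)
      refine (hbound u hu1).trans (mul_le_mul_of_nonneg_left ?_ h.2.2.2.1)
      exact Real.rpow_le_rpow (by linarith) (le_of_lt hu) h.2.1
    · rw [hf, Set.indicator_of_notMem ht, norm_zero]
      refine Set.indicator_nonneg (fun _ _ => ?_) _
      have := h.2.2.2.1
      positivity
  rw [h1]
  refine DifferentiableAt.comp s (g := mellin f) ?_ differentiableAt_id.neg
  refine mellin_differentiableAt_of_isBigO_rpow (a := -θ) (b := (-s).re - 1) hloc ?_ (by simpa using hs)
    ?_ (by linarith)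
  · rw [neg_neg]
    refine Asymptotics.IsBigO.of_bound K₀ ?_
    filter_upwards [eventually_ge_atTop 1] with u hu
    rw [Real.norm_of_nonneg (Real.rpow_nonneg (by linarith) _)]
    exact hbound u hu
  · refine Asymptotics.IsBigO.of_bound 0 ?_
    filter_upwards [Ioo_mem_nhdsGT hZ0] with u hu
    rw [hf, Set.indicator_of_notMem (by simp [hu.2.le])]
    simp

lemma integral_indicator_cpow {Z v : ℝ} (hZ : 0 < Z) (hv : Z < v) {s : ℂ} (hs : 0 < s.re) :
    ∫ u in Set.Ioi Z, (Set.Ici v).indicator (fun u : ℝ => (u : ℂ) ^ (-s - 1)) u =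
      (v : ℂ) ^ (-s) / s := by
  have hs0 : s ≠ 0 := by rintro rfl; simp at hs
  rw [setIntegral_indicator measurableSet_Ici,
    Set.inter_eq_self_of_subset_right (Set.Ici_subset_Ioi.mpr hv),
    integral_Ici_eq_integral_Ioi, integral_Ioi_cpow_of_lt (by simp; linarith) (hZ.trans hv),
    sub_add_cancel, neg_div_neg_eq]

lemma integral_indicator_rpow {Z v : ℝ} (hZ : 0 < Z) (hv : Z < v) {σ : ℝ} (hs : 0 < σ) :
    ∫ u in Set.Ioi Z, (Set.Ici v).indicator (fun u : ℝ => u ^ (-σ - 1)) u = v ^ (-σ) / σ := by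
  rw [setIntegral_indicator measurableSet_Ici,
    Set.inter_eq_self_of_subset_right (Set.Ici_subset_Ioi.mpr hv),
    integral_Ici_eq_integral_Ioi, integral_Ioi_rpow_of_lt (by linarith) (hZ.trans hv),
    sub_add_cancel, neg_div_neg_eq]

lemma card_filter_upTo {Z u : ℝ} (hu : Z ≤ u) :
    (((S.upTo u).filter fun n => Z < S.val n).card : ℝ) = S.cnt u - S.cnt Z := by
  classical
  have h1 : (S.upTo u).filter (fun n => Z < S.val n) = S.upTo u \ S.upTo Z := by
    ext n; simp
  have h2 : S.upTo Z ⊆ S.upTo u := fun n hn => by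
    rw [mem_upTo] at *; exact hn.trans hu
  rw [h1, Finset.card_sdiff_of_subset h2, Nat.cast_sub (Finset.card_le_card h2), cnt_eq_card,
    cnt_eq_card]

lemma WellBehaved.integral_cnt_sub (h : S.WellBehaved A θ K₀) {Z : ℝ} (hZ : 1 ≤ Z) {s : ℂ}
    (hs : 1 < s.re) :
    s * ∫ u in Set.Ioi Z, ((S.cnt u - S.cnt Z : ℝ) : ℂ) * (u : ℂ) ^ (-s - 1) =
      A * (Z : ℂ) ^ (1 - s) / (s - 1) - S.remainder A Z * (Z : ℂ) ^ (-s) + s * S.tail A Z s := by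
  have hZ0 : 0 < Z := by linarith
  have hs0 : s ≠ 0 := by rintro rfl; simp at hs; linarith
  have hs1 : s - 1 ≠ 0 := by
    intro h0; rw [sub_eq_zero] at h0; rw [h0] at hs; simp at hs
  have e : ∀ u ∈ Set.Ioi Z, ((S.cnt u - S.cnt Z : ℝ) : ℂ) * (u : ℂ) ^ (-s - 1) =
      A * (u : ℂ) ^ (-s) + (S.remainder A u : ℂ) * (u : ℂ) ^ (-s - 1) -
        S.cnt Z * (u : ℂ) ^ (-s - 1) := by
    intro u hu
    have hu0 : (u : ℂ) ≠ 0 := by exact_mod_cast (hZ0.trans hu).ne'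
    have e1 : (u : ℂ) ^ (-s) = u * (u : ℂ) ^ (-s - 1) := by
      rw [Complex.cpow_sub _ _ hu0, Complex.cpow_one]; field_simp
    rw [e1, remainder]; push_cast; ring
  have i1 : IntegrableOn (fun u : ℝ => (A : ℂ) * (u : ℂ) ^ (-s)) (Set.Ioi Z) :=
    (integrableOn_Ioi_cpow_of_lt (by simpa using hs) hZ0).const_mul _
  have i2 := h.integrableOn_remainder hZ (s := s) (by linarith [h.2.2.1])
  have i3 : IntegrableOn (fun u : ℝ => (S.cnt Z : ℂ) * (u : ℂ) ^ (-s - 1)) (Set.Ioi Z) :=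
    (integrableOn_Ioi_cpow_of_lt (by simp; linarith) hZ0).const_mul _
  have i12 : IntegrableOn (fun u : ℝ => (A : ℂ) * (u : ℂ) ^ (-s) +
      (S.remainder A u : ℂ) * (u : ℂ) ^ (-s - 1)) (Set.Ioi Z) := i1.add i2
  rw [setIntegral_congr_fun measurableSet_Ioi e, integral_sub i12 i3, integral_add i1 i2,
    integral_const_mul, integral_const_mul, integral_Ioi_cpow_of_lt (by simpa using hs) hZ0,
    integral_Ioi_cpow_of_lt (by simp; linarith) hZ0, ← tail, sub_add_cancel, remainder]
  have hZ' : (Z : ℂ) ≠ 0 := by exact_mod_cast hZ0.ne'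
  have e2 : (Z : ℂ) ^ (1 - s) = Z * (Z : ℂ) ^ (-s) := by
    rw [sub_eq_add_neg, Complex.cpow_add _ _ hZ', Complex.cpow_one]
  rw [neg_add_eq_sub, e2, ← neg_sub s 1]
  push_cast
  field_simp
  ring

lemma WellBehaved.tsum_eq (h : S.WellBehaved A θ K₀) {Z : ℝ} (hZ : 1 ≤ Z) {s : ℂ}
    (hs : 1 < s.re) :
    ∑' n, (S.val n : ℂ) ^ (-s) = ∑ n ∈ S.upTo Z, (S.val n : ℂ) ^ (-s) +
      (A * (Z : ℂ) ^ (1 - s) / (s - 1) - S.remainder A Z * (Z : ℂ) ^ (-s) + s * S.tail A Z s) := by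
  classical
  have hZ0 : 0 < Z := by linarith
  have hs0 : s ≠ 0 := by rintro rfl; simp at hs; linarith
  set G : (ℕ →₀ ℕ) → ℝ → ℂ := fun n =>
    if Z < S.val n then (Set.Ici (S.val n)).indicator fun u : ℝ => (u : ℂ) ^ (-s - 1) else 0 with hG
  have hsum := h.summable_norm_cpow hs
  set t := (fun n => if Z < S.val n then (S.val n : ℂ) ^ (-s) else 0) with ht
  have htail : Summable t := by
    refine Summable.of_norm (hsum.of_nonneg_of_le (fun _ => norm_nonneg _) fun n => ?_)
    simp only [ht]
    split_ifs <;> simp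
  have hGint : ∀ n, Integrable (G n) (volume.restrict (Set.Ioi Z)) := by
    intro n
    simp only [hG]
    split_ifs with hn
    · refine (integrable_indicator_iff measurableSet_Ici).mpr ?_
      rw [IntegrableOn, Measure.restrict_restrict measurableSet_Ici]
      exact (integrableOn_Ioi_cpow_of_lt (by simp; linarith) hZ0).mono_set Set.inter_subset_right
    · exact integrable_zero _ _ _
  have hval : ∀ n, s * ∫ u in Set.Ioi Z, G n u = t n := by
    intro n
    simp only [hG, ht]
    split_ifs with hn
    · rw [integral_indicator_cpow hZ0 hn (by linarith)]
      field_simp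
    · simp
  have hnorm : Summable fun n => ∫ u in Set.Ioi Z, ‖G n u‖ := by
    have h1 : ∀ n, ∫ u in Set.Ioi Z, ‖G n u‖ = ‖t n‖ / s.re := by
      intro n
      simp only [hG, ht]
      split_ifs with hn
      · rw [norm_val_cpow, ← integral_indicator_rpow hZ0 hn (by linarith)]
        refine setIntegral_congr_fun measurableSet_Ioi fun u hu => ?_
        rw [norm_indicator_eq_indicator_norm]
        by_cases hun : u ∈ Set.Ici (S.val n)
        · rw [Set.indicator_of_mem hun, Set.indicator_of_mem hun,
            Complex.norm_cpow_eq_rpow_re_of_pos (hZ0.trans hu)]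
          simp
        · rw [Set.indicator_of_notMem hun, Set.indicator_of_notMem hun]
      · simp
    simp only [h1]
    exact htail.norm.div_const _
  have hG2 : ∀ u ∈ Set.Ioi Z, ∑' n, G n u =
      ((S.cnt u - S.cnt Z : ℝ) : ℂ) * (u : ℂ) ^ (-s - 1) := by
    intro u hu
    have h1 : ∀ n, G n u = if n ∈ (S.upTo u).filter (fun n => Z < S.val n) then
        (u : ℂ) ^ (-s - 1) else 0 := by
      intro n
      simp only [hG, Finset.mem_filter, mem_upTo]
      by_cases h2 : Z < S.val n
      · by_cases h3 : S.val n ≤ u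
        · simp [h2, h3]
        · simp [h2, h3]
      · simp [h2]
    rw [tsum_eq_sum (s := (S.upTo u).filter (fun n => Z < S.val n))
      (fun n hn => by rw [h1, if_neg hn]), Finset.sum_congr rfl
      (fun n hn => by rw [h1, if_pos hn]), Finset.sum_const, nsmul_eq_mul,
      ← card_filter_upTo (le_of_lt hu)]
    norm_cast
  have hsplit : ∀ n, (S.val n : ℂ) ^ (-s) =
      (if n ∈ S.upTo Z then (S.val n : ℂ) ^ (-s) else 0) + t n := by
    intro n
    simp only [mem_upTo, ht]
    by_cases h2 : S.val n ≤ Z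
    · simp [h2, not_lt.mpr h2]
    · simp [h2, not_le.mp h2]
  have hfin : HasSum (fun n => if n ∈ S.upTo Z then (S.val n : ℂ) ^ (-s) else 0)
      (∑ n ∈ S.upTo Z, (S.val n : ℂ) ^ (-s)) := by
    have : HasSum (fun n => if n ∈ S.upTo Z then (S.val n : ℂ) ^ (-s) else 0)
        (∑ n ∈ S.upTo Z, if n ∈ S.upTo Z then (S.val n : ℂ) ^ (-s) else 0) :=
      hasSum_sum_of_ne_finset_zero fun n hn => if_neg hn
    rwa [Finset.sum_congr rfl fun n hn => if_pos hn] at this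
  rw [tsum_congr hsplit, hfin.summable.tsum_add htail, hfin.tsum_eq, ← h.integral_cnt_sub hZ hs,
    ← setIntegral_congr_fun measurableSet_Ioi hG2,
    ← integral_tsum_of_summable_integral_norm hGint hnorm, ← tsum_mul_left, tsum_congr hval]

/-- The right-hand side of the finite approximation to `(s - 1) * ζ s`. -/
noncomputable def approx (S : BeurlingSystem) (A Z : ℝ) (s : ℂ) : ℂ :=
  (s - 1) * (∑ n ∈ S.upTo Z, (S.val n : ℂ) ^ (-s) - S.remainder A Z * (Z : ℂ) ^ (-s) +
    s * S.tail A Z s) + A * (Z : ℂ) ^ (1 - s)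

lemma WellBehaved.differentiableOn_approx (h : S.WellBehaved A θ K₀) {Z : ℝ} (hZ : 1 ≤ Z) :
    DifferentiableOn ℂ (S.approx A Z) {s | θ < s.re} := by
  intro s hs
  have hZ0 : (Z : ℂ) ≠ 0 := by exact_mod_cast (by linarith : 0 < Z).ne'
  have h1 := h.differentiableAt_tail hZ hs
  have h2 : ∀ n, (S.val n : ℂ) ≠ 0 := fun n => by exact_mod_cast (S.val_pos n).ne'
  refine DifferentiableAt.differentiableWithinAt ?_
  unfold approx
  have h3 : DifferentiableAt ℂ (fun s => ∑ n ∈ S.upTo Z, (S.val n : ℂ) ^ (-s)) s :=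
    DifferentiableAt.fun_sum fun n _ =>
      (differentiableAt_id.neg).const_cpow (Or.inl (h2 n))
  have h4 : DifferentiableAt ℂ (fun s => (Z : ℂ) ^ (-s)) s :=
    (differentiableAt_id.neg).const_cpow (Or.inl hZ0)
  have h5 : DifferentiableAt ℂ (fun s => (Z : ℂ) ^ (1 - s)) s :=
    (differentiableAt_id.const_sub 1).const_cpow (Or.inl hZ0)
  fun_prop

lemma eqOn_of_convex {f g : ℂ → ℂ} {U V : Set ℂ} (hU : IsOpen U) (hc : Convex ℝ U)
    (hf : DifferentiableOn ℂ f U) (hg : DifferentiableOn ℂ g U) (hV : IsOpen V)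
    (hne : (U ∩ V).Nonempty) (hfg : Set.EqOn f g V) : Set.EqOn f g U := by
  obtain ⟨z, hzU, hzV⟩ := hne
  exact (hf.analyticOnNhd hU).eqOn_of_preconnected_of_eventuallyEq (hg.analyticOnNhd hU)
    hc.isPreconnected hzU (hfg.eventuallyEq_of_mem (hV.mem_nhds hzV))

lemma IsZeta.sub_one_mul_eq (hζ : S.IsZeta θ ζ) (h : S.WellBehaved A θ K₀) {Z : ℝ} (hZ : 1 ≤ Z)
    {s : ℂ} (hs : θ < s.re) (hs1 : s ≠ 1) : (s - 1) * ζ s = S.approx A Z s := by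
  set f : ℂ → ℂ := fun s => (s - 1) * ζ s with hf
  have hθ := h.2.2.1
  have hfd : DifferentiableOn ℂ f {s | θ < s.re ∧ s ≠ 1} :=
    (differentiableOn_id.sub_const 1).mul hζ.1
  have hgd := h.differentiableOn_approx hZ
  have e0 : Set.EqOn f (S.approx A Z) {s | 1 < s.re} := by
    intro s hs
    have hs' : s - 1 ≠ 0 := by
      intro h0; rw [sub_eq_zero] at h0; rw [h0] at hs; simp at hs
    simp only [hf, approx]
    rw [hζ.2 s hs, h.tsum_eq hZ hs]
    field_simp
    ring
  have o0 : IsOpen {s : ℂ | 1 < s.re} := isOpen_lt continuous_const Complex.continuous_re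
  have oθ : IsOpen {s : ℂ | θ < s.re} := isOpen_lt continuous_const Complex.continuous_re
  have key : ∀ U V : Set ℂ, IsOpen U → Convex ℝ U → IsOpen V → (U ∩ V).Nonempty →
      U ⊆ {s | θ < s.re ∧ s ≠ 1} → Set.EqOn f (S.approx A Z) V →
      Set.EqOn f (S.approx A Z) U := by
    intro U V hU hc hV hne hsub he
    exact eqOn_of_convex hU hc (hfd.mono hsub) (hgd.mono fun s hs => (hsub hs).1) hV hne he
  have cθ := convex_halfSpace_re_gt θ
  have e1 : Set.EqOn f (S.approx A Z) ({s | θ < s.re} ∩ {s | 0 < s.im}) := by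
    refine key _ _ (oθ.inter (isOpen_lt continuous_const Complex.continuous_im))
      (cθ.inter (convex_halfSpace_im_gt 0)) o0 ⟨⟨2, 1⟩, ?_⟩ ?_ e0
    · simp only [Set.mem_inter_iff, Set.mem_ofPred_eq]; refine ⟨⟨by linarith, by norm_num⟩, by norm_num⟩
    · rintro s ⟨h1, h2⟩
      refine ⟨h1, ?_⟩; rintro rfl; simp at h2
  have e2 : Set.EqOn f (S.approx A Z) ({s | θ < s.re} ∩ {s | s.im < 0}) := by
    refine key _ _ (oθ.inter (isOpen_lt Complex.continuous_im continuous_const))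
      (cθ.inter (convex_halfSpace_im_lt 0)) o0 ⟨⟨2, -1⟩, ?_⟩ ?_ e0
    · simp only [Set.mem_inter_iff, Set.mem_ofPred_eq]; refine ⟨⟨by linarith, by norm_num⟩, by norm_num⟩
    · rintro s ⟨h1, h2⟩
      refine ⟨h1, ?_⟩; rintro rfl; simp at h2
  have e3 : Set.EqOn f (S.approx A Z) ({s | θ < s.re} ∩ {s | s.re < 1}) := by
    refine key _ _ (oθ.inter (isOpen_lt Complex.continuous_re continuous_const))
      (cθ.inter (convex_halfSpace_re_lt 1)) (oθ.inter (isOpen_lt continuous_const Complex.continuous_im))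
      ⟨⟨(1 + θ) / 2, 1⟩, ?_⟩ ?_ e1
    · simp only [Set.mem_inter_iff, Set.mem_ofPred_eq]
      refine ⟨⟨by linarith, by linarith⟩, by linarith, by norm_num⟩
    · rintro s ⟨h1, h2⟩
      refine ⟨h1, ?_⟩; rintro rfl; simp at h2
  rcases lt_trichotomy s.im 0 with h1 | h1 | h1
  · exact e2 ⟨hs, h1⟩
  · rcases lt_trichotomy s.re 1 with h2 | h2 | h2
    · exact e3 ⟨hs, h2⟩
    · exact absurd (Complex.ext h2 h1) hs1
    · exact e0 h2
  · exact e1 ⟨hs, h1⟩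

end BeurlingSystem

lemma AnalyticOnNhd.card_zeros_le_log {c : ℂ} {r R M : ℝ} {f : ℂ → ℂ} (hr : 0 < r) (hrR : r < R)
    (hM : 1 ≤ M) (hf : AnalyticOnNhd ℂ f (Metric.closedBall c R)) (hc : f c ≠ 0)
    (hb : ∀ z ∈ Metric.sphere c R, ‖f z‖ ≤ M) (Γ : Finset ℂ)
    (hΓ : ∀ z ∈ Γ, f z = 0 ∧ z ∈ Metric.closedBall c r) :
    (Γ.card : ℝ) ≤ Real.log (M / ‖f c‖) / Real.log (R / r) := by
  have hR : 0 < R := hr.trans hrR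
  have h1 := AnalyticOnNhd.sum_divisor_le (f := f) (c := c) (r := r) (R := R) (M := M)
    (by rwa [abs_of_pos hr]) (by rwa [abs_of_pos hr, abs_of_pos hR]) hM
    (by rwa [abs_of_pos hR]) hc (by rwa [abs_of_pos hR])
  rw [abs_of_pos hr] at h1
  refine le_trans ?_ h1
  have hfr : AnalyticOnNhd ℂ f (Metric.closedBall c r) :=
    hf.mono (Metric.closedBall_subset_closedBall hrR.le)
  have hfin := (MeromorphicOn.divisor f (Metric.closedBall c r)).finiteSupport
    (isCompact_closedBall c r)
  have h2 : ∀ z ∈ Γ, 1 ≤ MeromorphicOn.divisor f (Metric.closedBall c r) z := by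
    intro z hz
    obtain ⟨hz0, hzr⟩ := hΓ z hz
    rw [MeromorphicOn.AnalyticOnNhd.divisor_apply hfr hzr]
    have hne0 : analyticOrderAt f z ≠ 0 := by
      rw [Ne, (hfr z hzr).analyticOrderAt_eq_zero]
      exact not_not.mpr hz0
    have hnetop : analyticOrderAt f z ≠ ⊤ := by
      rw [Ne, analyticOrderAt_eq_top]
      intro he
      have := hfr.eqOn_zero_of_preconnected_of_eventuallyEq_zero
        (convex_closedBall c r).isPreconnected hzr he
      exact hc (this (Metric.mem_closedBall_self hr.le))
    lift analyticOrderAt f z to ℕ using hnetop with k hk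
    have : k ≠ 0 := by simpa using hne0
    simp only [ENat.map_natCast]
    change (1 : ℤ) ≤ (k : ℤ)
    omega
  have h3 : (Γ.card : ℤ) ≤ ∑ᶠ u, MeromorphicOn.divisor f (Metric.closedBall c r) u := by
    rw [finsum_eq_sum _ hfin]
    calc (Γ.card : ℤ) = ∑ z ∈ Γ, 1 := by simp
      _ ≤ ∑ z ∈ Γ, MeromorphicOn.divisor f (Metric.closedBall c r) z := Finset.sum_le_sum h2
      _ ≤ _ := by
        refine Finset.sum_le_sum_of_subset_of_nonneg ?_ fun z _ _ => MeromorphicOn.AnalyticOnNhd.divisor_nonneg hfr z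
        intro z hz
        rw [Set.Finite.mem_toFinset, Function.mem_support]
        have := h2 z hz
        omega
  exact_mod_cast h3

namespace BeurlingSystem

variable {S : BeurlingSystem} {A θ K₀ : ℝ} {ζ : ℂ → ℂ}

lemma IsZeta.norm_sum_upTo_le (hζ : S.IsZeta θ ζ) (h : S.WellBehaved A θ K₀) {Z : ℝ} (hZ : 1 ≤ Z)
    {ρ : ℂ} (hρ : θ < ρ.re) (hρ1 : ρ ≠ 1) (h0 : ζ ρ = 0) :
    ‖∑ n ∈ S.upTo Z, (S.val n : ℂ) ^ (-ρ)‖ ≤ A * Z ^ (1 - ρ.re) / ‖ρ - 1‖ +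
      K₀ * Z ^ (θ - ρ.re) * (1 + ‖ρ‖ / (ρ.re - θ)) := by
  have hZ0 : 0 < Z := by linarith
  have hne : ρ - 1 ≠ 0 := sub_ne_zero.mpr hρ1
  have h1 := hζ.sub_one_mul_eq h hZ hρ hρ1
  rw [h0, mul_zero, approx] at h1
  have h2 : ∑ n ∈ S.upTo Z, (S.val n : ℂ) ^ (-ρ) =
      -(A * (Z : ℂ) ^ (1 - ρ) / (ρ - 1)) + (S.remainder A Z * (Z : ℂ) ^ (-ρ) -
        ρ * S.tail A Z ρ) := by
    field_simp
    linear_combination -h1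
  rw [h2]
  refine (norm_add_le _ _).trans (add_le_add ?_ ?_)
  · rw [norm_neg, norm_div, norm_mul, Complex.norm_real, Real.norm_of_nonneg h.1.le,
      Complex.norm_cpow_eq_rpow_re_of_pos hZ0]
    simp
  · refine (norm_sub_le _ _).trans ?_
    rw [mul_add, mul_one]
    refine add_le_add ?_ ?_
    · rw [norm_mul, Complex.norm_real, Complex.norm_cpow_eq_rpow_re_of_pos hZ0, sub_eq_add_neg,
        Real.rpow_add hZ0, ← mul_assoc, Complex.neg_re]
      exact mul_le_mul_of_nonneg_right (h.abs_remainder_le hZ) (Real.rpow_nonneg hZ0.le _)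
    · rw [norm_mul]
      refine (mul_le_mul_of_nonneg_left (h.norm_tail_le hZ hρ) (norm_nonneg _)).trans_eq ?_
      ring

lemma WellBehaved.norm_approx_one_le (h : S.WellBehaved A θ K₀) {η : ℝ} (hη : 0 < η) {s : ℂ}
    (hs : θ + η ≤ s.re) :
    ‖S.approx A 1 s‖ ≤ (1 + K₀ + K₀ / η + A) * (1 + ‖s‖) ^ 2 := by
  have hA := h.1
  have hK := h.2.2.2.1
  have h1 := h.norm_tail_le le_rfl (s := s) (by linarith)
  have h2 : K₀ * (1 : ℝ) ^ (θ - s.re) / (s.re - θ) ≤ K₀ / η := by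
    rw [Real.one_rpow, mul_one]
    exact div_le_div_of_nonneg_left hK hη (by linarith)
  have h3 : |S.remainder A 1| ≤ K₀ := by simpa using h.abs_remainder_le (le_refl (1 : ℝ))
  have h4 : S.approx A 1 s =
      (s - 1) * (1 - S.remainder A 1 + s * S.tail A 1 s) + A := by
    rw [approx, upTo_one]; simp [val_zero]
  have h5 : ‖s - 1‖ ≤ 1 + ‖s‖ := (norm_sub_le _ _).trans (by rw [norm_one, add_comm])
  have h6 : ‖(1 : ℂ) - S.remainder A 1 + s * S.tail A 1 s‖ ≤ 1 + K₀ + ‖s‖ * (K₀ / η) := by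
    refine (norm_add_le _ _).trans (add_le_add ((norm_sub_le _ _).trans ?_) ?_)
    · rw [norm_one, Complex.norm_real]
      exact add_le_add le_rfl h3
    · rw [norm_mul]
      exact mul_le_mul_of_nonneg_left (h1.trans h2) (norm_nonneg _)
  rw [h4]
  have hn := norm_nonneg s
  have hKη : 0 ≤ K₀ / η := by positivity
  calc _ ≤ ‖s - 1‖ * ‖(1 : ℂ) - S.remainder A 1 + s * S.tail A 1 s‖ + A := by
        refine (norm_add_le _ _).trans ?_
        rw [norm_mul, Complex.norm_real, Real.norm_of_nonneg hA.le]
    _ ≤ (1 + ‖s‖) * (1 + K₀ + ‖s‖ * (K₀ / η)) + A := by gcongr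
    _ ≤ (1 + K₀ + K₀ / η + A) * (1 + ‖s‖) ^ 2 := by
        nlinarith [mul_nonneg hn hK, mul_nonneg hn hKη, mul_nonneg hn hA.le, sq_nonneg ‖s‖,
          mul_nonneg (sq_nonneg ‖s‖) hK, mul_nonneg (sq_nonneg ‖s‖) hA.le,
          mul_nonneg (sq_nonneg ‖s‖) hKη]

lemma WellBehaved.exists_half_le_norm_tsum (h : S.WellBehaved A θ K₀) :
    ∃ σ₀ : ℝ, 2 ≤ σ₀ ∧ ∀ s : ℂ, σ₀ ≤ s.re → 1 / 2 ≤ ‖∑' n, (S.val n : ℂ) ^ (-s)‖ := by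
  classical
  set B := ∑' n, S.val n ^ (-2 : ℝ) with hB
  have hB0 : 0 ≤ B := tsum_nonneg fun n => Real.rpow_nonneg (S.val_pos n).le _
  have hp := S.one_lt_p 0
  have hlim : Tendsto (fun k : ℕ => B * ((S.p 0)⁻¹) ^ k) atTop (𝓝 0) := by
    simpa using (tendsto_pow_atTop_nhds_zero_of_lt_one (by positivity)
      (inv_lt_one_of_one_lt₀ hp)).const_mul B
  obtain ⟨k, hk⟩ := (hlim.eventually (gt_mem_nhds (show (0 : ℝ) < 1 / 2 by norm_num))).exists
  refine ⟨2 + k, by linarith [k.cast_nonneg (α := ℝ)], fun s hs => ?_⟩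
  have hs1 : 1 < s.re := by linarith [k.cast_nonneg (α := ℝ)]
  have hsum := h.summable_norm_cpow hs1
  rw [hsum.of_norm.tsum_eq_add_tsum_ite 0]
  have h1 : ∀ n, ‖if n = 0 then (0 : ℂ) else (S.val n : ℂ) ^ (-s)‖ ≤
      S.val n ^ (-2 : ℝ) * ((S.p 0)⁻¹) ^ k := by
    intro n
    split_ifs with hn
    · rw [norm_zero]
      have := S.val_pos n
      positivity
    · rw [norm_val_cpow]
      calc S.val n ^ (-s.re) ≤ S.val n ^ (-2 + -(k : ℝ)) :=
            Real.rpow_le_rpow_of_exponent_le (S.one_le_val n) (by linarith)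
        _ = S.val n ^ (-2 : ℝ) * (S.val n ^ k)⁻¹ := by
            rw [Real.rpow_add (S.val_pos n), Real.rpow_neg (S.val_pos n).le k, Real.rpow_natCast]
        _ ≤ _ := by
            rw [inv_pow]
            have h2 := S.p_zero_le_val hn
            have := S.val_pos n
            gcongr
  have h2 : ‖∑' n, if n = 0 then (0 : ℂ) else (S.val n : ℂ) ^ (-s)‖ ≤ 1 / 2 := by
    refine (tsum_of_norm_bounded ((h.summable one_lt_two).mul_right _).hasSum h1).trans ?_
    rw [tsum_mul_right]
    exact hk.le
  have h3 : (S.val 0 : ℂ) ^ (-s) = 1 := by simp [val_zero]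
  rw [h3]
  have h4 := norm_sub_le_norm_add (1 : ℂ) (∑' n, if n = 0 then (0 : ℂ) else (S.val n : ℂ) ^ (-s))
  rw [norm_one] at h4
  linarith

lemma norm_sub_le_of_abs_le {z c : ℂ} {d κ : ℝ} (hd : 0 ≤ d) (hκ : 0 ≤ κ) (hdκ : 1 ≤ κ * d)
    (hre : |z.re - c.re| ≤ d) (him : |z.im - c.im| ≤ 1) : ‖z - c‖ ≤ d + κ := by
  refine abs_le_of_sq_le_sq' ?_ (by positivity) |>.2
  rw [Complex.sq_norm, Complex.normSq_apply, Complex.sub_re, Complex.sub_im, ← sq, ← sq]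
  have h1 := (sq_le_sq' (abs_le.mp hre).1 (abs_le.mp hre).2)
  have h2 := (sq_le_sq' (abs_le.mp him).1 (abs_le.mp him).2)
  nlinarith [sq_nonneg κ]

lemma IsZeta.exists_card_zeros_le (hζ : S.IsZeta θ ζ) (h : S.WellBehaved A θ K₀) {α : ℝ}
    (hα : θ < α) (hα1 : α ≤ 1) :
    ∃ C : ℝ, 0 < C ∧ ∀ (t : ℝ) (Γ : Finset ℂ),
      (∀ ρ ∈ Γ, ζ ρ = 0 ∧ ρ ≠ 1 ∧ α ≤ ρ.re ∧ ρ.re ≤ 1 ∧ |ρ.im - t| ≤ 1) →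
      (Γ.card : ℝ) ≤ C * (1 + Real.log (2 + |t|)) := by
  obtain ⟨σ₁, hσ₁, hhalf⟩ := h.exists_half_le_norm_tsum
  obtain ⟨κ, hκ⟩ : ∃ κ, κ = (α - θ) / 4 := ⟨_, rfl⟩
  have hκ0 : 0 < κ := by linarith
  obtain ⟨d, hd1, hd2⟩ : ∃ d, σ₁ - α ≤ d ∧ κ⁻¹ ≤ d :=
    ⟨max (σ₁ - α) κ⁻¹, le_max_left _ _, le_max_right _ _⟩
  have hd0 : 0 < d := (inv_pos.mpr hκ0).trans_le hd2
  have hdκ : 1 ≤ κ * d := by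
    calc 1 = κ * κ⁻¹ := (mul_inv_cancel₀ hκ0.ne').symm
      _ ≤ κ * d := by gcongr
  obtain ⟨σ₀, hσ₀⟩ : ∃ σ₀, σ₀ = α + d := ⟨_, rfl⟩
  have hσ₀1 : σ₁ ≤ σ₀ := by linarith
  have hr : 0 < d + κ := by positivity
  obtain ⟨R, hR⟩ : ∃ R, R = d + 2 * κ := ⟨_, rfl⟩
  have hrR : d + κ < R := by linarith
  have hK := h.2.2.2.1
  have hA := h.1
  obtain ⟨C₁, hC₁⟩ : ∃ C₁, C₁ = 1 + K₀ + K₀ / κ + A := ⟨_, rfl⟩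
  have hC₁1 : 1 ≤ C₁ := by
    have : 0 ≤ K₀ / κ := by positivity
    linarith
  obtain ⟨D, hD⟩ : ∃ D, D = 1 + σ₀ + R := ⟨_, rfl⟩
  have hD1 : 1 ≤ D := by linarith
  have hL0 : 0 ≤ Real.log (2 * C₁ * D ^ 2) :=
    Real.log_nonneg (by nlinarith [one_le_pow₀ hD1 (n := 2)])
  have hlogr : 0 < Real.log (R / (d + κ)) := Real.log_pos ((one_lt_div hr).mpr hrR)
  refine ⟨(Real.log (2 * C₁ * D ^ 2) + 2) / Real.log (R / (d + κ)), by positivity,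
    fun t Γ hΓ => ?_⟩
  obtain ⟨c, hcre', hcim⟩ : ∃ c : ℂ, c.re = σ₀ ∧ c.im = t := ⟨⟨σ₀, t⟩, rfl, rfl⟩
  have ht := abs_nonneg t
  have hDt : 1 ≤ D * (2 + |t|) := by nlinarith
  have hM1 : 1 ≤ C₁ * (D * (2 + |t|)) ^ 2 := by nlinarith [one_le_pow₀ hDt (n := 2)]
  have hballre : ∀ z ∈ Metric.closedBall c R, θ + κ ≤ z.re := by
    intro z hz
    have h1 : |(z - c).re| ≤ R :=
      (Complex.abs_re_le_norm _).trans (by rwa [Metric.mem_closedBall, dist_eq_norm] at hz)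
    have h2 := (abs_le.mp h1).1
    rw [Complex.sub_re] at h2
    linarith
  have hcre : θ < c.re := by linarith [h.2.2.1]
  have hc1 : c ≠ 1 := by
    intro h0
    have := congrArg Complex.re h0
    rw [Complex.one_re] at this
    linarith
  have hfc : 1 / 2 ≤ ‖S.approx A 1 c‖ := by
    rw [← hζ.sub_one_mul_eq h le_rfl hcre hc1, norm_mul, hζ.2 c (by linarith)]
    have h1 := hhalf c (by linarith)
    have h2 : 1 ≤ ‖c - 1‖ := by
      refine le_trans ?_ (Complex.re_le_norm _)
      rw [Complex.sub_re, Complex.one_re]; linarith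
    calc (1 : ℝ) / 2 = 1 * (1 / 2) := (one_mul _).symm
      _ ≤ _ := mul_le_mul h2 h1 (by norm_num) (norm_nonneg _)
  have hcard := AnalyticOnNhd.card_zeros_le_log (f := S.approx A 1) (c := c)
    (M := C₁ * (D * (2 + |t|)) ^ 2) hr hrR hM1 ?_ ?_ ?_ Γ ?_
  · refine hcard.trans ?_
    rw [div_mul_eq_mul_div]
    refine div_le_div_of_nonneg_right ?_ hlogr.le
    calc Real.log (C₁ * (D * (2 + |t|)) ^ 2 / ‖S.approx A 1 c‖)
        ≤ Real.log (C₁ * (D * (2 + |t|)) ^ 2 / (1 / 2)) := by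
          refine Real.log_le_log (div_pos (by linarith) (by linarith)) ?_
          exact div_le_div_of_nonneg_left (by linarith) (by norm_num) hfc
      _ = Real.log (2 * C₁ * D ^ 2 * (2 + |t|) ^ 2) := by congr 1; ring
      _ = Real.log (2 * C₁ * D ^ 2) + 2 * Real.log (2 + |t|) := by
          rw [Real.log_mul (by positivity) (by positivity), Real.log_pow]; norm_num
      _ ≤ (Real.log (2 * C₁ * D ^ 2) + 2) * (1 + Real.log (2 + |t|)) := by
          have := Real.log_nonneg (show (1 : ℝ) ≤ 2 + |t| by linarith)
          nlinarith
  · intro z hz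
    exact (h.differentiableOn_approx le_rfl).analyticOnNhd
      (isOpen_lt continuous_const Complex.continuous_re) z
      (show θ < z.re by linarith [hballre z hz])
  · intro h0
    rw [h0, norm_zero] at hfc
    linarith
  · intro z hz
    refine (h.norm_approx_one_le hκ0 (hballre z (Metric.sphere_subset_closedBall hz))).trans ?_
    have h1 : ‖z‖ ≤ σ₀ + |t| + R := by
      have h2 : ‖z - c‖ = R := by rwa [mem_sphere_iff_norm] at hz
      have h3 : ‖c‖ ≤ σ₀ + |t| := by
        refine (Complex.norm_le_abs_re_add_abs_im c).trans_eq ?_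
        rw [hcre', hcim, abs_of_nonneg (by linarith)]
      have h4 : ‖z‖ ≤ ‖z - c‖ + ‖c‖ := by simpa using norm_add_le (z - c) c
      linarith
    have h5 : 1 + ‖z‖ ≤ D * (2 + |t|) := by
      have : 1 * |t| ≤ D * |t| := mul_le_mul_of_nonneg_right hD1 ht
      linarith
    rw [← hC₁]
    gcongr
  · intro ρ hρ
    obtain ⟨h0, h1, h2, h3, h4⟩ := hΓ ρ hρ
    refine ⟨?_, ?_⟩
    · rw [← hζ.sub_one_mul_eq h le_rfl (by linarith) h1, h0, mul_zero]
    · rw [Metric.mem_closedBall, dist_eq_norm]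
      refine norm_sub_le_of_abs_le hd0.le hκ0.le hdκ ?_ (by rwa [hcim])
      rw [hcre', abs_le]
      constructor <;> linarith

/-- The number of divisors of a generalized integer is `O(n ^ η)` for every `η > 0`. -/
lemma exists_card_antidiagonal_le (S : BeurlingSystem) {η : ℝ} (hη : 0 < η) :
    ∃ C : ℝ, 1 ≤ C ∧ ∀ n : ℕ →₀ ℕ,
      ((Finset.HasAntidiagonal.antidiagonal n).card : ℝ) ≤ C * S.val n ^ η := by
  classical
  have hp0 : ∀ k, 0 < S.p k := fun k => one_pos.trans (S.one_lt_p k)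
  obtain ⟨K, hK⟩ := (S.p_tendsto.eventually_ge_atTop ((2 : ℝ) ^ (1 / η))).exists_forall_of_atTop
  have hbig : ∀ k, K ≤ k → (2 : ℝ) ≤ S.p k ^ η := by
    intro k hk
    calc (2 : ℝ) = ((2 : ℝ) ^ (1 / η)) ^ η := by
          rw [← Real.rpow_mul (by norm_num), one_div, inv_mul_cancel₀ hη.ne', Real.rpow_one]
      _ ≤ _ := Real.rpow_le_rpow (by positivity) (hK k hk) hη.le
  have hfac : ∀ k, ∃ c : ℝ, 1 ≤ c ∧ ∀ e : ℕ, ((e : ℝ) + 1) ≤ c * (S.p k ^ η) ^ e := by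
    intro k
    have h1 : 1 < S.p k ^ η := Real.one_lt_rpow (S.one_lt_p k) hη
    set w := S.p k ^ η - 1 with hw
    have hw0 : 0 < w := by linarith
    refine ⟨max 1 (1 / w), le_max_left _ _, fun e => ?_⟩
    have h2 : 1 + (e : ℝ) * w ≤ (1 + w) ^ e := one_add_mul_le_pow (by linarith) e
    have h3 : S.p k ^ η = 1 + w := by rw [hw]; ring
    rw [h3]
    have h4 : (1 : ℝ) ≤ max 1 (1 / w) * 1 := by simp
    have h5 : 1 ≤ max 1 (1 / w) * w := by
      calc 1 = 1 / w * w := by field_simp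
        _ ≤ _ := by gcongr; exact le_max_right _ _
    have he : (0 : ℝ) ≤ e := e.cast_nonneg
    calc (e : ℝ) + 1 ≤ e * (max 1 (1 / w) * w) + max 1 (1 / w) * 1 :=
          add_le_add (le_mul_of_one_le_right he h5) h4
      _ = max 1 (1 / w) * (1 + e * w) := by ring
      _ ≤ _ := by gcongr
  choose c hc1 hc using hfac
  refine ⟨∏ k ∈ Finset.range K, c k, Finset.one_le_prod fun k _ => hc1 k, fun n => ?_⟩
  have hcard : (Finset.HasAntidiagonal.antidiagonal n).card ≤ ∏ k ∈ n.support, (n k + 1) := by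
    calc (Finset.HasAntidiagonal.antidiagonal n).card ≤ (Finset.Iic n).card := by
          refine Finset.card_le_card_of_injOn Prod.fst ?_ ?_
          · intro q hq
            have := Finset.HasAntidiagonal.mem_antidiagonal.mp hq
            simp only [Finset.coe_Iic, Set.mem_Iic]
            rw [← this]; exact le_self_add
          · intro q hq r hr hqr
            have h1 := Finset.HasAntidiagonal.mem_antidiagonal.mp hq
            have h2 := Finset.HasAntidiagonal.mem_antidiagonal.mp hr
            refine Prod.ext hqr ?_
            rw [← h2, hqr] at h1
            exact add_left_cancel h1
      _ = _ := by rw [Finsupp.card_Iic]; simp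
  have hval : S.val n ^ η = ∏ k ∈ n.support, (S.p k ^ η) ^ n k := by
    rw [val, Finsupp.prod, ← Real.finsetProd_rpow _ _ fun k _ => (pow_pos (hp0 k) _).le]
    refine Finset.prod_congr rfl fun k _ => ?_
    rw [Real.rpow_pow_comm (hp0 k).le]
  calc ((Finset.HasAntidiagonal.antidiagonal n).card : ℝ)
      ≤ ∏ k ∈ n.support, ((n k : ℝ) + 1) := by exact_mod_cast hcard
    _ ≤ ∏ k ∈ n.support, ((if k < K then c k else 1) * (S.p k ^ η) ^ n k) := by
        refine Finset.prod_le_prod (fun k _ => by positivity) fun k _ => ?_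
        split_ifs with hk
        · exact hc k _
        · rw [one_mul]
          have h2 := hbig k (not_lt.mp hk)
          calc (n k : ℝ) + 1 ≤ 2 ^ n k := by exact_mod_cast Nat.lt_two_pow_self
            _ ≤ _ := by gcongr
    _ = (∏ k ∈ n.support, if k < K then c k else 1) * S.val n ^ η := by
        rw [Finset.prod_mul_distrib, hval]
    _ ≤ _ := by
        refine mul_le_mul_of_nonneg_right ?_ (Real.rpow_nonneg (S.val_pos n).le _)
        rw [← Finset.prod_filter]
        refine Finset.prod_le_prod_of_subset_of_one_le ?_ ?_ ?_
        · intro k hk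
          simpa using (Finset.mem_filter.mp hk).2
        · intro k _; linarith [hc1 k]
        · intro k _ _; exact hc1 k

/-- The coefficients of the product of the truncated zeta sum with the truncated Möbius sum. -/
noncomputable def mollCoeff (S : BeurlingSystem) (X Z : ℝ) (n : ℕ →₀ ℕ) : ℝ := by
  classical
  exact ∑ q ∈ (S.upTo X ×ˢ S.upTo Z).filter (fun q => q.1 + q.2 = n), gMoebius q.1

lemma abs_mollCoeff_le (S : BeurlingSystem) (X Z : ℝ) (n : ℕ →₀ ℕ) :
    |S.mollCoeff X Z n| ≤ ((Finset.HasAntidiagonal.antidiagonal n).card : ℝ) := by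
  classical
  rw [mollCoeff]
  refine (Finset.abs_sum_le_sum_abs _ _).trans ?_
  refine (Finset.sum_le_card_nsmul _ _ 1 fun q _ => abs_gMoebius_le _).trans ?_
  rw [nsmul_one]
  refine Nat.cast_le.mpr (Finset.card_le_card fun q hq => ?_)
  exact Finset.HasAntidiagonal.mem_antidiagonal.mpr (Finset.mem_filter.mp hq).2

lemma mollCoeff_of_val_le (S : BeurlingSystem) {X Z : ℝ} (hXZ : X ≤ Z) {n : ℕ →₀ ℕ}
    (hn : S.val n ≤ X) : S.mollCoeff X Z n = if n = 0 then 1 else 0 := by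
  classical
  have h1 : (S.upTo X ×ˢ S.upTo Z).filter (fun q => q.1 + q.2 = n) =
      Finset.HasAntidiagonal.antidiagonal n := by
    ext q
    rw [Finset.mem_filter, Finset.mem_product, mem_upTo, mem_upTo,
      Finset.HasAntidiagonal.mem_antidiagonal]
    refine ⟨And.right, fun hq => ⟨?_, hq⟩⟩
    have h2 : S.val q.1 * S.val q.2 = S.val n := by rw [← val_add, hq]
    have h3 := S.one_le_val q.1
    have h4 := S.one_le_val q.2
    constructor <;> nlinarith
  rw [mollCoeff, h1]
  split_ifs with h0
  · subst h0
    simp [gMoebius_zero]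
  · exact sum_gMoebius_antidiagonal h0

lemma sum_gMoebius_mul_sum (S : BeurlingSystem) {X Z : ℝ} (hX : 1 ≤ X) (hXZ : X ≤ Z) (s : ℂ) :
    (∑ d ∈ S.upTo X, (gMoebius d : ℂ) * (S.val d : ℂ) ^ (-s)) *
      (∑ m ∈ S.upTo Z, (S.val m : ℂ) ^ (-s)) =
    1 + ∑ n ∈ (S.upTo (X * Z)).filter (fun n => X < S.val n),
      (S.mollCoeff X Z n : ℂ) * (S.val n : ℂ) ^ (-s) := by
  classical
  have hX0 : 0 ≤ X := by linarith
  have h1 : (∑ d ∈ S.upTo X, (gMoebius d : ℂ) * (S.val d : ℂ) ^ (-s)) *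
      (∑ m ∈ S.upTo Z, (S.val m : ℂ) ^ (-s)) =
      ∑ n ∈ S.upTo (X * Z), (S.mollCoeff X Z n : ℂ) * (S.val n : ℂ) ^ (-s) := by
    rw [Finset.sum_mul_sum, ← Finset.sum_product',
      ← Finset.sum_fiberwise_of_maps_to (t := S.upTo (X * Z)) (g := fun q => q.1 + q.2)]
    · refine Finset.sum_congr rfl fun n _ => ?_
      rw [mollCoeff, Complex.ofReal_sum, Finset.sum_mul]
      refine Finset.sum_congr rfl fun q hq => ?_
      rw [← (Finset.mem_filter.mp hq).2, val_add_cpow]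
      ring
    · intro q hq
      rw [Finset.mem_product, mem_upTo, mem_upTo] at hq
      rw [mem_upTo, val_add]
      exact mul_le_mul hq.1 hq.2 (S.val_pos _).le hX0
  rw [h1, ← Finset.sum_filter_add_sum_filter_not _ (fun n => X < S.val n), add_comm]
  congr 1
  rw [Finset.sum_eq_single 0]
  · rw [mollCoeff_of_val_le S hXZ (by rw [val_zero]; exact hX)]
    simp [val_zero]
  · intro n hn h0
    rw [mollCoeff_of_val_le S hXZ (not_lt.mp (Finset.mem_filter.mp hn).2), if_neg h0]
    simp
  · intro h0
    refine absurd ?_ h0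
    rw [Finset.mem_filter, mem_upTo, val_zero, not_lt]
    exact ⟨by nlinarith, hX⟩

lemma WellBehaved.norm_sum_gMoebius_le (h : S.WellBehaved A θ K₀) {X α η : ℝ}
    (hX : 0 ≤ X) (hα : α ≤ 1) (hη : 0 < η) {s : ℂ} (hs : α ≤ s.re) :
    ‖∑ d ∈ S.upTo X, (gMoebius d : ℂ) * (S.val d : ℂ) ^ (-s)‖ ≤
      (∑' n, S.val n ^ (-(1 + η))) * X ^ (1 - α + η) := by
  have hsum := h.summable (σ := 1 + η) (by linarith)
  calc _ ≤ ∑ d ∈ S.upTo X, S.val d ^ (-(1 + η)) * X ^ (1 - α + η) := by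
        refine norm_sum_le_of_le _ fun d hd => ?_
        have hv := S.val_pos d
        rw [norm_mul, norm_val_cpow, Complex.norm_real, Real.norm_eq_abs]
        calc |gMoebius d| * S.val d ^ (-s.re) ≤ 1 * S.val d ^ (-(1 + η) + (1 - α + η)) :=
              mul_le_mul (abs_gMoebius_le d)
                (Real.rpow_le_rpow_of_exponent_le (S.one_le_val d) (by linarith))
                (Real.rpow_nonneg hv.le _) zero_le_one
          _ ≤ _ := by
              rw [one_mul, Real.rpow_add hv]
              exact mul_le_mul_of_nonneg_left
                (Real.rpow_le_rpow hv.le ((S.mem_upTo).mp hd) (by linarith))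
                (Real.rpow_nonneg hv.le _)
    _ ≤ _ := by
        rw [← Finset.sum_mul]
        exact mul_le_mul_of_nonneg_right (hsum.sum_le_tsum _ fun n _ =>
          Real.rpow_nonneg (S.val_pos n).le _) (Real.rpow_nonneg hX _)

/-- A zero of the zeta function forces a long mollified Dirichlet polynomial to be large. -/
lemma IsZeta.half_le_norm_sum_mollCoeff (hζ : S.IsZeta θ ζ) (h : S.WellBehaved A θ K₀)
    {X Z α η : ℝ} (hX : 1 ≤ X) (hXZ : X ≤ Z) (hα : α ≤ 1) (hθα : θ < α) (hη : 0 < η) {ρ : ℂ}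
    (hρ : α ≤ ρ.re) (hρ1 : ρ ≠ 1) (h0 : ζ ρ = 0)
    (hsmall : ((∑' n, S.val n ^ (-(1 + η))) * X ^ (1 - α + η)) *
      (A * Z ^ (1 - α) / ‖ρ - 1‖ + K₀ * Z ^ (θ - α) * (1 + ‖ρ‖ / (α - θ))) ≤ 1 / 2) :
    1 / 2 ≤ ‖∑ n ∈ (S.upTo (X * Z)).filter (fun n => X < S.val n),
      (S.mollCoeff X Z n : ℂ) * (S.val n : ℂ) ^ (-ρ)‖ := by
  have hZ : 1 ≤ Z := hX.trans hXZ
  have hA := h.1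
  have hK := h.2.2.2.1
  have h1 := S.sum_gMoebius_mul_sum hX hXZ ρ
  have h2 := h.norm_sum_gMoebius_le (X := X) (by linarith) hα hη hρ
  have h3 : ‖∑ n ∈ S.upTo Z, (S.val n : ℂ) ^ (-ρ)‖ ≤
      A * Z ^ (1 - α) / ‖ρ - 1‖ + K₀ * Z ^ (θ - α) * (1 + ‖ρ‖ / (α - θ)) := by
    refine (hζ.norm_sum_upTo_le h hZ (by linarith) hρ1 h0).trans ?_
    have h4 : Z ^ (1 - ρ.re) ≤ Z ^ (1 - α) :=
      Real.rpow_le_rpow_of_exponent_le hZ (by linarith)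
    have h5 : Z ^ (θ - ρ.re) ≤ Z ^ (θ - α) :=
      Real.rpow_le_rpow_of_exponent_le hZ (by linarith)
    have h6 : 0 < α - θ := by linarith
    have h7 : α - θ ≤ ρ.re - θ := by linarith
    have h8 : 0 < ρ.re - θ := by linarith
    gcongr
  have h4 := mul_le_mul h2 h3 (norm_nonneg _) ((norm_nonneg _).trans h2)
  rw [← norm_mul, h1] at h4
  have h5 := norm_sub_le_norm_add (1 : ℂ) (∑ n ∈ (S.upTo (X * Z)).filter (fun n => X < S.val n),
      (S.mollCoeff X Z n : ℂ) * (S.val n : ℂ) ^ (-ρ))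
  rw [norm_one] at h5
  linarith

end BeurlingSystem

section GaussianMeanValue

open MeasureTheory Complex

variable {ι : Type*}

/-- The exponential polynomial `∑ b n exp (-i τ n t)`. -/
noncomputable def expPoly (s : Finset ι) (b : ι → ℂ) (τ : ι → ℝ) (t : ℝ) : ℂ :=
  ∑ n ∈ s, b n * cexp (-(I * τ n * t))

lemma continuous_expPoly (s : Finset ι) (b : ι → ℂ) (τ : ι → ℝ) : Continuous (expPoly s b τ) := by
  unfold expPoly
  fun_prop

lemma norm_expPoly_le (s : Finset ι) (b : ι → ℂ) (τ : ι → ℝ) (t : ℝ) :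
    ‖expPoly s b τ t‖ ≤ ∑ n ∈ s, ‖b n‖ := by
  refine norm_sum_le_of_le _ fun n _ => ?_
  rw [norm_mul, norm_exp]
  simp

lemma integrable_gaussian_mul {f : ℝ → ℝ} (hf : Continuous f) {B : ℝ} (hB : ∀ t, |f t| ≤ B)
    {c : ℝ} (hc : 0 < c) (γ : ℝ) : Integrable fun t : ℝ => Real.exp (-c * (t - γ) ^ 2) * f t := by
  have h1 : Integrable fun t : ℝ => Real.exp (-c * (t - γ) ^ 2) :=
    (integrable_exp_neg_mul_sq hc).comp_sub_right γ
  exact h1.mul_bdd (c := B) hf.aestronglyMeasurable (Eventually.of_forall hB)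

lemma integral_gaussian_mul_expPoly (s : Finset ι) (a : ι → ℂ) (τ : ι → ℝ) (L α h γ : ℝ) :
    ∫ u : ℝ, cexp (-(u + I * h) ^ 2 + I * u * L) *
      expPoly s (fun n => a n * cexp (-(α * τ n) + (τ n - L) ^ 2 / 4)) τ (u + γ) =
    (Real.pi : ℂ) ^ (1 / 2 : ℂ) * cexp (h * L) *
      ∑ n ∈ s, a n * cexp (-(((α + h : ℝ) : ℂ) + γ * I) * τ n) := by
  have h1 : ∀ u : ℝ, cexp (-(u + I * h) ^ 2 + I * u * L) *
      expPoly s (fun n => a n * cexp (-(α * τ n) + (τ n - L) ^ 2 / 4)) τ (u + γ) =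
      ∑ n ∈ s, (a n * cexp (-(α * τ n) + (τ n - L) ^ 2 / 4) * cexp (-(I * τ n * γ))) *
        cexp (-1 * (u : ℂ) ^ 2 + (-(2 * I * h) - I * (τ n - L)) * u + h ^ 2) := by
    intro u
    rw [expPoly, Finset.mul_sum]
    refine Finset.sum_congr rfl fun n _ => ?_
    have h2 : cexp (-(u + I * h) ^ 2 + I * u * L) * cexp (-(I * τ n * ((u + γ : ℝ) : ℂ))) =
        cexp (-(I * τ n * γ)) *
        cexp (-1 * (u : ℂ) ^ 2 + (-(2 * I * h) - I * (τ n - L)) * u + h ^ 2) := by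
      rw [← Complex.exp_add, ← Complex.exp_add]
      congr 1
      push_cast
      linear_combination -(h : ℂ) ^ 2 * I_sq
    linear_combination (a n * cexp (-(α * τ n) + (τ n - L) ^ 2 / 4)) * h2
  simp only [h1]
  rw [integral_finsetSum]
  · rw [Finset.mul_sum]
    refine Finset.sum_congr rfl fun n _ => ?_
    rw [integral_const_mul, integral_cexp_quadratic (by simp)]
    have h2 : cexp (-(α * τ n) + (τ n - L) ^ 2 / 4) * cexp (-(I * τ n * γ)) *
        cexp ((h : ℂ) ^ 2 - (-(2 * I * h) - I * (τ n - L)) ^ 2 / (4 * -1)) =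
        cexp (h * L) * cexp (-(((α + h : ℝ) : ℂ) + γ * I) * τ n) := by
      rw [← Complex.exp_add, ← Complex.exp_add, ← Complex.exp_add]
      congr 1
      push_cast
      linear_combination ((2 * h + (τ n - L)) ^ 2 / 4 : ℂ) * I_sq
    rw [neg_neg, div_one]
    linear_combination (a n * (Real.pi : ℂ) ^ (1 / 2 : ℂ)) * h2
  · intro n _
    exact (integrable_cexp_quadratic (b := 1) (by simp) _ _).const_mul _

lemma sq_integral_gaussian_mul_le {f : ℝ → ℝ} (hf : Continuous f) {B : ℝ} (hB : ∀ t, |f t| ≤ B) :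
    (∫ u : ℝ, Real.exp (-u ^ 2) * f u) ^ 2 ≤ √Real.pi * ∫ u : ℝ, Real.exp (-u ^ 2) * f u ^ 2 := by
  have hπ : 0 < √Real.pi := Real.sqrt_pos.mpr Real.pi_pos
  have h0 : ∫ u : ℝ, Real.exp (-u ^ 2) = √Real.pi := by simpa using integral_gaussian 1
  have hI0 : Integrable fun u : ℝ => Real.exp (-u ^ 2) := by
    simpa using integrable_exp_neg_mul_sq (b := 1) one_pos
  have hI1 : Integrable fun u : ℝ => Real.exp (-u ^ 2) * f u := by
    simpa using integrable_gaussian_mul hf hB one_pos 0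
  have hI2 : Integrable fun u : ℝ => Real.exp (-u ^ 2) * f u ^ 2 := by
    have hB2 : ∀ t, |f t ^ 2| ≤ B ^ 2 := fun t => by
      rw [abs_pow]; exact pow_le_pow_left₀ (abs_nonneg _) (hB t) 2
    simpa using integrable_gaussian_mul (hf.pow 2) hB2 one_pos 0
  obtain ⟨m, hm⟩ : ∃ m, m = ∫ u : ℝ, Real.exp (-u ^ 2) * f u := ⟨_, rfl⟩
  have h1 : 0 ≤ ∫ u : ℝ, Real.exp (-u ^ 2) * (√Real.pi * f u - m) ^ 2 :=
    integral_nonneg fun u => by positivity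
  have h2 : ∫ u : ℝ, Real.exp (-u ^ 2) * (√Real.pi * f u - m) ^ 2 =
      √Real.pi ^ 2 * (∫ u : ℝ, Real.exp (-u ^ 2) * f u ^ 2) - 2 * √Real.pi * m * m +
        m ^ 2 * √Real.pi := by
    have h3 : ∀ u : ℝ, Real.exp (-u ^ 2) * (√Real.pi * f u - m) ^ 2 =
        √Real.pi ^ 2 * (Real.exp (-u ^ 2) * f u ^ 2) -
          2 * √Real.pi * m * (Real.exp (-u ^ 2) * f u) + m ^ 2 * Real.exp (-u ^ 2) := by
      intro u; ring
    simp only [h3]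
    have h4 : Integrable fun u : ℝ => √Real.pi ^ 2 * (Real.exp (-u ^ 2) * f u ^ 2) -
        2 * √Real.pi * m * (Real.exp (-u ^ 2) * f u) := (hI2.const_mul _).sub (hI1.const_mul _)
    rw [integral_add h4 (hI0.const_mul _),
      integral_sub (hI2.const_mul _) (hI1.const_mul _), integral_const_mul, integral_const_mul,
      integral_const_mul, h0, ← hm]
  rw [h2] at h1
  rw [← hm]
  have h3 : 0 ≤ √Real.pi * (√Real.pi * (∫ u : ℝ, Real.exp (-u ^ 2) * f u ^ 2) - m ^ 2) := by
    linarith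
  have := nonneg_of_mul_nonneg_right h3 hπ
  linarith

lemma norm_sq_sum_exp_le (s : Finset ι) (a : ι → ℂ) (τ : ι → ℝ) {L α h : ℝ} (γ : ℝ) (hL : 0 ≤ L)
    (hh : 0 ≤ h) (hh1 : h ≤ 1) :
    ‖∑ n ∈ s, a n * cexp (-(((α + h : ℝ) : ℂ) + γ * I) * τ n)‖ ^ 2 ≤
      Real.exp 2 / √Real.pi * ∫ t : ℝ, Real.exp (-(t - γ) ^ 2) *
        ‖expPoly s (fun n => a n * cexp (-(α * τ n) + (τ n - L) ^ 2 / 4)) τ t‖ ^ 2 := by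
  have hπ : 0 < √Real.pi := Real.sqrt_pos.mpr Real.pi_pos
  have h1 := integral_gaussian_mul_expPoly s a τ L α h γ
  obtain ⟨g, hg⟩ : ∃ g, g = expPoly s (fun n => a n * cexp (-(α * τ n) + (τ n - L) ^ 2 / 4)) τ :=
    ⟨_, rfl⟩
  obtain ⟨F, hF⟩ : ∃ F, F = ∑ n ∈ s, a n * cexp (-(((α + h : ℝ) : ℂ) + γ * I) * τ n) := ⟨_, rfl⟩
  have hgc : Continuous g := by rw [hg]; exact continuous_expPoly _ _ _
  obtain ⟨B, hB⟩ : ∃ B, ∀ t, ‖g t‖ ≤ B := by rw [hg]; exact ⟨_, norm_expPoly_le _ _ _⟩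
  rw [← hg, ← hF] at h1
  rw [← hg, ← hF]
  have h2 : √Real.pi * ‖F‖ ≤ Real.exp 1 * ∫ u : ℝ, Real.exp (-u ^ 2) * ‖g (u + γ)‖ := by
    calc √Real.pi * ‖F‖ ≤ ‖(Real.pi : ℂ) ^ (1 / 2 : ℂ) * cexp (h * L) * F‖ := by
          rw [norm_mul, norm_mul, norm_exp, norm_cpow_eq_rpow_re_of_pos Real.pi_pos,
            Real.sqrt_eq_rpow]
          refine mul_le_mul_of_nonneg_right ?_ (norm_nonneg _)
          rw [show (1 / 2 : ℂ).re = 1 / 2 by norm_num]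
          refine le_mul_of_one_le_right (by positivity) (Real.one_le_exp ?_)
          rw [← ofReal_mul, ofReal_re]
          positivity
      _ ≤ ∫ u : ℝ, Real.exp 1 * (Real.exp (-u ^ 2) * ‖g (u + γ)‖) := by
          rw [← h1]
          refine norm_integral_le_of_norm_le ?_ (Eventually.of_forall fun u => ?_)
          · refine Integrable.const_mul ?_ _
            have := integrable_gaussian_mul (f := fun u => ‖g (u + γ)‖) (by fun_prop) (B := B)
              (fun t => by rw [abs_norm]; exact hB _) one_pos 0
            simpa using this
          · rw [norm_mul, norm_exp, ← mul_assoc]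
            refine mul_le_mul_of_nonneg_right ?_ (norm_nonneg _)
            rw [← Real.exp_add]
            refine Real.exp_le_exp.mpr ?_
            simp only [sq, add_re, neg_re, mul_re, ofReal_re, I_re, ofReal_im, I_im, add_im, mul_im]
            nlinarith
      _ = _ := integral_const_mul _ _
  have h3 := sq_integral_gaussian_mul_le (f := fun u => ‖g (u + γ)‖) (by fun_prop) (B := B)
    (fun t => by rw [abs_norm]; exact hB _)
  have h4 : ∫ u : ℝ, Real.exp (-u ^ 2) * ‖g (u + γ)‖ ^ 2 =
      ∫ t : ℝ, Real.exp (-(t - γ) ^ 2) * ‖g t‖ ^ 2 := by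
    rw [← integral_add_right_eq_self (fun t => Real.exp (-(t - γ) ^ 2) * ‖g t‖ ^ 2) γ]
    simp
  rw [h4] at h3
  have h5 : (√Real.pi * ‖F‖) ^ 2 ≤ Real.exp 1 ^ 2 *
      (√Real.pi * ∫ t : ℝ, Real.exp (-(t - γ) ^ 2) * ‖g t‖ ^ 2) := by
    calc (√Real.pi * ‖F‖) ^ 2 ≤ (Real.exp 1 * ∫ u : ℝ, Real.exp (-u ^ 2) * ‖g (u + γ)‖) ^ 2 :=
          pow_le_pow_left₀ (by positivity) h2 2
      _ ≤ _ := by rw [mul_pow]; gcongr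
  have h6 : Real.exp 1 ^ 2 = Real.exp 2 := by rw [← Real.exp_nat_mul]; norm_num
  rw [h6] at h5
  rw [div_mul_eq_mul_div, le_div_iff₀ hπ]
  refine le_of_mul_le_mul_left ?_ hπ
  calc √Real.pi * (‖F‖ ^ 2 * √Real.pi) = (√Real.pi * ‖F‖) ^ 2 := by ring
    _ ≤ _ := h5
    _ = _ := by ring

lemma sum_exp_neg_mul_abs_le (F : Finset ℤ) (j : ℤ) {q : ℝ} (hq : 0 < q) (hq1 : q ≤ 1) :
    ∑ k ∈ F, Real.exp (-(q * |((j - k : ℤ) : ℝ)|)) ≤ 4 / q := by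
  classical
  have hr0 : (0 : ℝ) ≤ Real.exp (-q) := (Real.exp_pos _).le
  have hr1 : Real.exp (-q) < 1 := Real.exp_lt_one_iff.mpr (by linarith)
  have hgeo : ∑' n : ℕ, Real.exp (-q) ^ n ≤ 2 / q := by
    rw [tsum_geometric_of_lt_one hr0 hr1]
    have h1 : q / 2 ≤ 1 - Real.exp (-q) := by
      have h2 : Real.exp (-q) ≤ 1 / (1 + q) := by
        rw [Real.exp_neg, ← one_div]
        exact one_div_le_one_div_of_le (by linarith) (by linarith [Real.add_one_le_exp q])
      have h3 : 1 / (1 + q) ≤ 1 - q / 2 := by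
        rw [div_le_iff₀ (by linarith)]; nlinarith
      linarith
    calc (1 - Real.exp (-q))⁻¹ ≤ (q / 2)⁻¹ := inv_anti₀ (by linarith) h1
      _ = 2 / q := by rw [inv_div]
  have hterm : ∀ k : ℤ, Real.exp (-(q * |((j - k : ℤ) : ℝ)|)) = Real.exp (-q) ^ (j - k).natAbs := by
    intro k
    rw [← Real.exp_nat_mul, ← Int.cast_abs, Int.abs_eq_natAbs, Int.cast_natCast]
    congr 1; ring
  have hpart : ∀ G : Finset ℤ, (∀ k ∈ G, ∀ l ∈ G, (j - k).natAbs = (j - l).natAbs → k = l) →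
      ∑ k ∈ G, Real.exp (-q) ^ (j - k).natAbs ≤ 2 / q := by
    intro G hG
    rw [← Finset.sum_image (f := fun n : ℕ => Real.exp (-q) ^ n) (g := fun k => (j - k).natAbs)]
    · exact ((summable_geometric_of_lt_one hr0 hr1).sum_le_tsum _ fun n _ => by positivity).trans
        hgeo
    · intro k hk l hl h
      exact hG k hk l hl h
  simp only [hterm]
  rw [← Finset.sum_filter_add_sum_filter_not F (fun k => k ≤ j)]
  have h1 := hpart (F.filter fun k => k ≤ j) (by
    intro k hk l hl h
    have := (Finset.mem_filter.mp hk).2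
    have := (Finset.mem_filter.mp hl).2
    omega)
  have h2 := hpart (F.filter fun k => ¬ k ≤ j) (by
    intro k hk l hl h
    have := (Finset.mem_filter.mp hk).2
    have := (Finset.mem_filter.mp hl).2
    omega)
  calc _ ≤ 2 / q + 2 / q := add_le_add h1 h2
    _ = 4 / q := by ring

lemma sum_exp_neg_sq_sub_im_le (Γ : Finset ℂ) {W T : ℝ} (hT : 1 ≤ T) (hΓ : ∀ ρ ∈ Γ, |ρ.im| ≤ T)
    (hW : ∀ k : ℤ, ((Γ.filter fun ρ => ⌊ρ.im⌋ = k).card : ℝ) ≤ W) (t : ℝ) :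
    ∑ ρ ∈ Γ, Real.exp (-(t - ρ.im) ^ 2) ≤
      4 * Real.exp 3 * W * Real.exp (-(1 / (4 * T ^ 2)) * t ^ 2) := by
  classical
  have hT2 : 1 ≤ T ^ 2 := one_le_pow₀ hT
  have hpt : ∀ ρ ∈ Γ, Real.exp (-(t - ρ.im) ^ 2) ≤
      Real.exp 3 * Real.exp (-(1 / (4 * T ^ 2)) * t ^ 2) *
        Real.exp (-(1 * |((⌊t⌋ - ⌊ρ.im⌋ : ℤ) : ℝ)|)) := by
    intro ρ hρ
    rw [← Real.exp_add, ← Real.exp_add]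
    refine Real.exp_le_exp.mpr ?_
    obtain ⟨y, hy⟩ : ∃ y, y = ρ.im := ⟨_, rfl⟩
    have hyT : y ^ 2 ≤ T ^ 2 := by
      rw [hy, ← sq_abs]; exact pow_le_pow_left₀ (abs_nonneg _) (hΓ ρ hρ) 2
    rw [← hy]
    have h1 : 1 / (4 * T ^ 2) * t ^ 2 ≤ (t - y) ^ 2 / 2 + 1 / 2 := by
      rw [div_mul_eq_mul_div, div_le_iff₀ (by positivity)]
      nlinarith [sq_nonneg (t - 2 * y), mul_le_mul_of_nonneg_left hT2 (sq_nonneg (t - y))]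
    have h2 : |((⌊t⌋ - ⌊y⌋ : ℤ) : ℝ)| ≤ |t - y| + 1 := by
      have a1 := Int.floor_le t
      have a2 := Int.lt_floor_add_one t
      have a3 := Int.floor_le y
      have a4 := Int.lt_floor_add_one y
      push_cast
      rw [abs_le]
      constructor
      · linarith [neg_abs_le (t - y)]
      · linarith [le_abs_self (t - y)]
    have h3 : |t - y| ≤ (t - y) ^ 2 / 2 + 1 / 2 := by
      rw [← sq_abs (t - y)]; nlinarith [sq_nonneg (|t - y| - 1)]
    linarith
  refine (Finset.sum_le_sum hpt).trans ?_
  rw [← Finset.mul_sum]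
  have hsum : ∑ ρ ∈ Γ, Real.exp (-(1 * |((⌊t⌋ - ⌊ρ.im⌋ : ℤ) : ℝ)|)) ≤ W * (4 / 1) := by
    have hW0 : 0 ≤ W := (Nat.cast_nonneg _).trans (hW 0)
    rw [← Finset.sum_fiberwise_of_maps_to (t := Γ.image fun ρ => ⌊ρ.im⌋) (g := fun ρ => ⌊ρ.im⌋)
      fun ρ hρ => Finset.mem_image_of_mem _ hρ]
    refine le_trans ?_ (mul_le_mul_of_nonneg_left
      (sum_exp_neg_mul_abs_le (Γ.image fun ρ => ⌊ρ.im⌋) ⌊t⌋ one_pos le_rfl) hW0)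
    rw [Finset.mul_sum]
    refine Finset.sum_le_sum fun k _ => ?_
    rw [Finset.sum_congr rfl fun ρ hρ => by rw [(Finset.mem_filter.mp hρ).2], Finset.sum_const,
      nsmul_eq_mul]
    exact mul_le_mul_of_nonneg_right (hW k) (Real.exp_pos _).le
  calc _ ≤ Real.exp 3 * Real.exp (-(1 / (4 * T ^ 2)) * t ^ 2) * (W * (4 / 1)) :=
        mul_le_mul_of_nonneg_left hsum (by positivity)
    _ = _ := by ring

lemma integral_gaussian_mul_norm_expPoly_sq_le (s : Finset ι) (b : ι → ℂ) (τ : ι → ℝ) {c : ℝ}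
    (hc : 0 < c) :
    ∫ t : ℝ, Real.exp (-c * t ^ 2) * ‖expPoly s b τ t‖ ^ 2 ≤
      √(Real.pi / c) * ∑ m ∈ s, ∑ n ∈ s, ‖b m‖ * ‖b n‖ *
        Real.exp (-(τ m - τ n) ^ 2 / (4 * c)) := by
  have h1 : ((∫ t : ℝ, Real.exp (-c * t ^ 2) * ‖expPoly s b τ t‖ ^ 2 : ℝ) : ℂ) =
      ∑ m ∈ s, ∑ n ∈ s, (b m * (starRingEnd ℂ) (b n)) *
        ((Real.pi / c : ℂ) ^ (1 / 2 : ℂ) * cexp (-(τ m - τ n) ^ 2 / (4 * c))) := by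
    rw [← integral_complex_ofReal]
    have h2 : ∀ t : ℝ, ((Real.exp (-c * t ^ 2) * ‖expPoly s b τ t‖ ^ 2 : ℝ) : ℂ) =
        ∑ m ∈ s, ∑ n ∈ s, (b m * (starRingEnd ℂ) (b n)) *
          cexp (-(c : ℂ) * (t : ℂ) ^ 2 + (-(I * (τ m - τ n))) * t + 0) := by
      intro t
      rw [ofReal_mul, ofReal_pow, ← Complex.mul_conj', expPoly, map_sum, Finset.sum_mul_sum,
        Finset.mul_sum]
      refine Finset.sum_congr rfl fun m _ => ?_
      rw [Finset.mul_sum]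
      refine Finset.sum_congr rfl fun n _ => ?_
      rw [map_mul, ← Complex.exp_conj]
      have h3 : ((Real.exp (-c * t ^ 2) : ℝ) : ℂ) * (cexp (-(I * τ m * t)) *
          cexp ((starRingEnd ℂ) (-(I * τ n * t)))) =
          cexp (-(c : ℂ) * (t : ℂ) ^ 2 + (-(I * (τ m - τ n))) * t + 0) := by
        rw [ofReal_exp, ← Complex.exp_add, ← Complex.exp_add]
        congr 1
        simp only [map_neg, map_mul, conj_I, conj_ofReal]
        push_cast
        ring
      linear_combination (b m * (starRingEnd ℂ) (b n)) * h3
    have h_int : ∀ m n, Integrable fun t : ℝ => (b m * (starRingEnd ℂ) (b n)) *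
          cexp (-(c : ℂ) * (t : ℂ) ^ 2 + (-(I * (τ m - τ n))) * t + 0) := fun m n =>
      (integrable_cexp_quadratic (b := (c : ℂ)) (by simpa using hc) _ _).const_mul _
    rw [integral_congr_ae (Eventually.of_forall h2),
      integral_finsetSum _ fun m _ => integrable_finsetSum _ fun n _ => h_int m n]
    refine Finset.sum_congr rfl fun m _ => ?_
    rw [integral_finsetSum _ fun n _ => h_int m n]
    refine Finset.sum_congr rfl fun n _ => ?_
    rw [integral_const_mul, integral_cexp_quadratic (by simpa using hc), neg_neg]
    congr 3
    have hc' : (c : ℂ) ≠ 0 := by exact_mod_cast hc.ne'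
    field_simp
    linear_combination ((τ m - τ n : ℂ)) ^ 2 * I_sq
  have h0 : 0 ≤ ∫ t : ℝ, Real.exp (-c * t ^ 2) * ‖expPoly s b τ t‖ ^ 2 :=
    integral_nonneg fun t => by positivity
  rw [← Real.norm_of_nonneg h0, ← Complex.norm_real, h1, Finset.mul_sum]
  refine norm_sum_le_of_le _ fun m _ => ?_
  rw [Finset.mul_sum]
  refine norm_sum_le_of_le _ fun n _ => le_of_eq ?_
  rw [norm_mul, norm_mul, norm_mul, RCLike.norm_conj, ← ofReal_div,
    norm_cpow_eq_rpow_re_of_pos (by positivity), norm_exp, Real.sqrt_eq_rpow]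
  have h4 : (-((τ m : ℂ) - τ n) ^ 2 / (4 * c)).re = -(τ m - τ n) ^ 2 / (4 * c) := by
    rw [← ofReal_re (-(τ m - τ n) ^ 2 / (4 * c))]
    push_cast
    rfl
  rw [h4, show (1 / 2 : ℂ).re = 1 / 2 by norm_num]
  ring

/-- A mean value estimate over well-spaced points for exponential polynomials whose frequencies
lie in a unit interval. -/
lemma sum_norm_sq_sum_exp_le (s : Finset ι) (a : ι → ℂ) (τ : ι → ℝ) {L α W T : ℝ} (hL : 0 ≤ L)
    (hτ : ∀ n ∈ s, L ≤ τ n ∧ τ n ≤ L + 1) (hT : 1 ≤ T) (Γ : Finset ℂ)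
    (hΓ : ∀ ρ ∈ Γ, α ≤ ρ.re ∧ ρ.re ≤ α + 1 ∧ |ρ.im| ≤ T)
    (hW : ∀ k : ℤ, ((Γ.filter fun ρ => ⌊ρ.im⌋ = k).card : ℝ) ≤ W) :
    ∑ ρ ∈ Γ, ‖∑ n ∈ s, a n * cexp (-ρ * τ n)‖ ^ 2 ≤
      8 * Real.exp 6 * W * T * ∑ m ∈ s, ∑ n ∈ s, (‖a m‖ * Real.exp (-(α * τ m))) *
        (‖a n‖ * Real.exp (-(α * τ n))) * Real.exp (-(T * (τ m - τ n)) ^ 2) := by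
  have hT0 : 0 < T := by linarith
  have hW0 : 0 ≤ W := (Nat.cast_nonneg _).trans (hW 0)
  have hπ : 0 < √Real.pi := Real.sqrt_pos.mpr Real.pi_pos
  obtain ⟨b, hb⟩ : ∃ b : ι → ℂ, b = fun n => a n * cexp (-(α * τ n) + (τ n - L) ^ 2 / 4) :=
    ⟨_, rfl⟩
  obtain ⟨g, hg⟩ : ∃ g, g = expPoly s b τ := ⟨_, rfl⟩
  have hgc : Continuous g := by rw [hg]; exact continuous_expPoly _ _ _
  obtain ⟨B, hB⟩ : ∃ B, ∀ t, ‖g t‖ ≤ B := by rw [hg]; exact ⟨_, norm_expPoly_le _ _ _⟩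
  have hB2 : ∀ t, |‖g t‖ ^ 2| ≤ B ^ 2 := fun t => by
    rw [abs_pow, abs_norm]; exact pow_le_pow_left₀ (norm_nonneg _) (hB t) 2
  have hgc2 : Continuous fun t => ‖g t‖ ^ 2 := by fun_prop
  have hbn : ∀ n ∈ s, ‖b n‖ ≤ Real.exp (1 / 4) * (‖a n‖ * Real.exp (-(α * τ n))) := by
    intro n hn
    obtain ⟨h1, h2⟩ := hτ n hn
    have h3 : ((-(α * τ n) + (τ n - L) ^ 2 / 4 : ℂ)).re = -(α * τ n) + (τ n - L) ^ 2 / 4 := by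
      rw [← ofReal_re (-(α * τ n) + (τ n - L) ^ 2 / 4)]
      push_cast
      rfl
    rw [hb, norm_mul, norm_exp, h3, Real.exp_add]
    have h4 : Real.exp ((τ n - L) ^ 2 / 4) ≤ Real.exp (1 / 4) :=
      Real.exp_le_exp.mpr (by nlinarith)
    calc ‖a n‖ * (Real.exp (-(α * τ n)) * Real.exp ((τ n - L) ^ 2 / 4))
        ≤ ‖a n‖ * (Real.exp (-(α * τ n)) * Real.exp (1 / 4)) := by gcongr
      _ = _ := by ring
  have h1 : ∀ ρ ∈ Γ, ‖∑ n ∈ s, a n * cexp (-ρ * τ n)‖ ^ 2 ≤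
      Real.exp 2 / √Real.pi * ∫ t : ℝ, Real.exp (-(t - ρ.im) ^ 2) * ‖g t‖ ^ 2 := by
    intro ρ hρ
    obtain ⟨h1, h2, -⟩ := hΓ ρ hρ
    have h3 := norm_sq_sum_exp_le s a τ (L := L) (α := α) (h := ρ.re - α) ρ.im hL (by linarith)
      (by linarith)
    rw [add_sub_cancel, re_add_im, ← hb, ← hg] at h3
    exact h3
  have h_int : ∀ ρ ∈ Γ, Integrable fun t : ℝ => Real.exp (-(t - ρ.im) ^ 2) * ‖g t‖ ^ 2 := by
    intro ρ _
    simpa using integrable_gaussian_mul hgc2 hB2 one_pos ρ.im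
  have hc : 0 < 1 / (4 * T ^ 2) := by positivity
  have h2 : ∑ ρ ∈ Γ, ∫ t : ℝ, Real.exp (-(t - ρ.im) ^ 2) * ‖g t‖ ^ 2 ≤
      ∫ t : ℝ, 4 * Real.exp 3 * W * (Real.exp (-(1 / (4 * T ^ 2)) * t ^ 2) * ‖g t‖ ^ 2) := by
    rw [← integral_finsetSum _ h_int]
    refine integral_mono (integrable_finsetSum _ h_int) ?_ fun t => ?_
    · have := integrable_gaussian_mul hgc2 hB2 hc 0
      simp only [sub_zero] at this
      exact this.const_mul _
    · simp only
      rw [← Finset.sum_mul, ← mul_assoc]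
      exact mul_le_mul_of_nonneg_right
        (sum_exp_neg_sq_sub_im_le Γ hT (fun ρ hρ => (hΓ ρ hρ).2.2) hW t) (by positivity)
  rw [integral_const_mul] at h2
  have h3 := integral_gaussian_mul_norm_expPoly_sq_le s b τ hc
  rw [← hg] at h3
  have h4 : √(Real.pi / (1 / (4 * T ^ 2))) = √Real.pi * (2 * T) := by
    rw [show Real.pi / (1 / (4 * T ^ 2)) = Real.pi * (2 * T) ^ 2 by field_simp; ring,
      Real.sqrt_mul Real.pi_pos.le, Real.sqrt_sq (by positivity)]
  have h5 : ∑ m ∈ s, ∑ n ∈ s, ‖b m‖ * ‖b n‖ *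
        Real.exp (-(τ m - τ n) ^ 2 / (4 * (1 / (4 * T ^ 2)))) ≤
      Real.exp 1 * ∑ m ∈ s, ∑ n ∈ s, (‖a m‖ * Real.exp (-(α * τ m))) *
        (‖a n‖ * Real.exp (-(α * τ n))) * Real.exp (-(T * (τ m - τ n)) ^ 2) := by
    rw [Finset.mul_sum]
    refine Finset.sum_le_sum fun m hm => ?_
    rw [Finset.mul_sum]
    refine Finset.sum_le_sum fun n hn => ?_
    have h6 : -(τ m - τ n) ^ 2 / (4 * (1 / (4 * T ^ 2))) = -(T * (τ m - τ n)) ^ 2 := by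
      field_simp
    have h7 : Real.exp (1 / 4) * Real.exp (1 / 4) ≤ Real.exp 1 := by
      rw [← Real.exp_add]; exact Real.exp_le_exp.mpr (by norm_num)
    rw [h6]
    calc ‖b m‖ * ‖b n‖ * Real.exp (-(T * (τ m - τ n)) ^ 2)
        ≤ (Real.exp (1 / 4) * (‖a m‖ * Real.exp (-(α * τ m)))) *
          (Real.exp (1 / 4) * (‖a n‖ * Real.exp (-(α * τ n)))) *
            Real.exp (-(T * (τ m - τ n)) ^ 2) := by
          gcongr
          · exact hbn m hm
          · exact hbn n hn
      _ = (Real.exp (1 / 4) * Real.exp (1 / 4)) * ((‖a m‖ * Real.exp (-(α * τ m))) *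
        (‖a n‖ * Real.exp (-(α * τ n))) * Real.exp (-(T * (τ m - τ n)) ^ 2)) := by ring
      _ ≤ _ := by gcongr
  rw [h4] at h3
  obtain ⟨Q, hQ⟩ : ∃ Q, Q = ∑ m ∈ s, ∑ n ∈ s, (‖a m‖ * Real.exp (-(α * τ m))) *
        (‖a n‖ * Real.exp (-(α * τ n))) * Real.exp (-(T * (τ m - τ n)) ^ 2) := ⟨_, rfl⟩
  rw [← hQ] at h5 ⊢
  calc _ ≤ ∑ ρ ∈ Γ, Real.exp 2 / √Real.pi * ∫ t : ℝ, Real.exp (-(t - ρ.im) ^ 2) * ‖g t‖ ^ 2 :=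
        Finset.sum_le_sum h1
    _ ≤ Real.exp 2 / √Real.pi * (4 * Real.exp 3 * W * (√Real.pi * (2 * T) * (Real.exp 1 * Q))) := by
        rw [← Finset.mul_sum]
        gcongr
        refine h2.trans ?_
        gcongr
        refine h3.trans ?_
        gcongr
    _ = 8 * Real.exp 6 * W * T * Q := by
        have h8 : Real.exp 6 = Real.exp 2 * Real.exp 3 * Real.exp 1 := by
          rw [← Real.exp_add, ← Real.exp_add]; norm_num
        rw [h8]
        field_simp
        ring

end GaussianMeanValue

lemma sum_sum_exp_neg_mul_abs_sub_le {ι : Type*} (s : Finset ι) (f : ι → ℤ) {q : ℝ} (hq : 0 < q)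
    (hq1 : q ≤ 1) :
    ∑ m ∈ s, ∑ n ∈ s, Real.exp (-(q * |((f m - f n : ℤ) : ℝ)|)) ≤
      4 / q * ∑ n ∈ s, ((s.filter fun m => f m = f n).card : ℝ) := by
  classical
  obtain ⟨J, hJ⟩ : ∃ J, J = s.image f := ⟨_, rfl⟩
  have hmaps : ∀ n ∈ s, f n ∈ J := fun n hn => by rw [hJ]; exact Finset.mem_image_of_mem _ hn
  obtain ⟨r, hr⟩ : ∃ r : ℤ → ℝ, ∀ k, r k = ((s.filter fun m => f m = k).card : ℝ) :=
    ⟨_, fun _ => rfl⟩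
  have hcell : ∀ g : ℤ → ℝ, ∑ n ∈ s, g (f n) = ∑ k ∈ J, r k * g k := by
    intro g
    rw [← Finset.sum_fiberwise_of_maps_to hmaps]
    refine Finset.sum_congr rfl fun k _ => ?_
    rw [Finset.sum_congr rfl fun n hn => by rw [(Finset.mem_filter.mp hn).2], Finset.sum_const,
      nsmul_eq_mul, hr]
  have h1 : ∑ m ∈ s, ∑ n ∈ s, Real.exp (-(q * |((f m - f n : ℤ) : ℝ)|)) =
      ∑ j ∈ J, ∑ k ∈ J, r j * r k * Real.exp (-(q * |((j - k : ℤ) : ℝ)|)) := by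
    rw [hcell fun j => ∑ n ∈ s, Real.exp (-(q * |((j - f n : ℤ) : ℝ)|))]
    refine Finset.sum_congr rfl fun j _ => ?_
    rw [hcell fun k => Real.exp (-(q * |((j - k : ℤ) : ℝ)|)), Finset.mul_sum]
    exact Finset.sum_congr rfl fun k _ => by ring
  have h2 : ∑ n ∈ s, ((s.filter fun m => f m = f n).card : ℝ) = ∑ k ∈ J, r k ^ 2 := by
    simp only [← hr]
    rw [hcell r]
    exact Finset.sum_congr rfl fun k _ => by ring
  have h3 : ∑ j ∈ J, ∑ k ∈ J, r j ^ 2 * Real.exp (-(q * |((j - k : ℤ) : ℝ)|)) ≤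
      4 / q * ∑ k ∈ J, r k ^ 2 := by
    rw [Finset.mul_sum]
    refine Finset.sum_le_sum fun j _ => ?_
    rw [← Finset.mul_sum, mul_comm]
    exact mul_le_mul_of_nonneg_right (sum_exp_neg_mul_abs_le J j hq hq1) (sq_nonneg _)
  have h4 : ∑ j ∈ J, ∑ k ∈ J, r k ^ 2 * Real.exp (-(q * |((j - k : ℤ) : ℝ)|)) ≤
      4 / q * ∑ k ∈ J, r k ^ 2 := by
    rw [Finset.sum_comm]
    refine le_trans (le_of_eq ?_) h3
    refine Finset.sum_congr rfl fun j _ => Finset.sum_congr rfl fun k _ => ?_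
    rw [Int.cast_sub, Int.cast_sub, abs_sub_comm]
  rw [h1, h2]
  have h5 : ∑ j ∈ J, ∑ k ∈ J, r j * r k * Real.exp (-(q * |((j - k : ℤ) : ℝ)|)) ≤
      ∑ j ∈ J, ∑ k ∈ J, (r j ^ 2 * Real.exp (-(q * |((j - k : ℤ) : ℝ)|)) / 2 +
        r k ^ 2 * Real.exp (-(q * |((j - k : ℤ) : ℝ)|)) / 2) := by
    refine Finset.sum_le_sum fun j _ => Finset.sum_le_sum fun k _ => ?_
    have h6 : r j * r k ≤ (r j ^ 2 + r k ^ 2) / 2 := by nlinarith [sq_nonneg (r j - r k)]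
    calc _ ≤ (r j ^ 2 + r k ^ 2) / 2 * Real.exp (-(q * |((j - k : ℤ) : ℝ)|)) :=
          mul_le_mul_of_nonneg_right h6 (Real.exp_pos _).le
      _ = _ := by ring
  simp only [Finset.sum_add_distrib, ← Finset.sum_div] at h5
  linarith

lemma exp_neg_sq_mul_log_sub_log_le {x y N T q : ℝ} (hN : 0 < N) (hx : 0 < x) (hy : 0 < y)
    (hxN : x ≤ 2 * N) (hyN : y ≤ 2 * N) (hq : 0 ≤ q) (hq1 : q ≤ 1) (hqT : q ≤ T / (2 * N)) :
    Real.exp (-(T * (Real.log x - Real.log y)) ^ 2) ≤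
      Real.exp 2 * Real.exp (-(q * |((⌊x⌋ - ⌊y⌋ : ℤ) : ℝ)|)) := by
  have hlog : ∀ u v : ℝ, 0 < u → 0 < v → u ≤ v → v ≤ 2 * N →
      |v - u| / (2 * N) ≤ |Real.log v - Real.log u| := by
    intro u v hu hv huv hvN
    rw [abs_of_nonneg (sub_nonneg.mpr huv),
      abs_of_nonneg (sub_nonneg.mpr (Real.log_le_log hu huv))]
    have h1 := Real.log_le_sub_one_of_pos (div_pos hu hv)
    rw [Real.log_div hu.ne' hv.ne'] at h1
    have h2 : (v - u) / (2 * N) ≤ (v - u) / v :=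
      div_le_div_of_nonneg_left (sub_nonneg.mpr huv) hv hvN
    have h3 : (v - u) / v = 1 - u / v := by field_simp
    linarith
  have h1 : |x - y| / (2 * N) ≤ |Real.log x - Real.log y| := by
    rcases le_total x y with h | h
    · rw [abs_sub_comm x y, abs_sub_comm (Real.log x)]
      exact hlog x y hx hy h hyN
    · exact hlog y x hy hx h hxN
  have hT : 0 ≤ T := by
    by_contra hneg
    have := div_neg_of_neg_of_pos (not_le.mp hneg) (show 0 < 2 * N by linarith)
    linarith
  have h2 : q * |x - y| ≤ |T * (Real.log x - Real.log y)| := by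
    rw [abs_mul, abs_of_nonneg hT]
    calc q * |x - y| ≤ T / (2 * N) * |x - y| := by gcongr
      _ = T * (|x - y| / (2 * N)) := by ring
      _ ≤ _ := by gcongr
  have h3 : |((⌊x⌋ - ⌊y⌋ : ℤ) : ℝ)| ≤ |x - y| + 1 := by
    have a1 := Int.floor_le x
    have a2 := Int.lt_floor_add_one x
    have a3 := Int.floor_le y
    have a4 := Int.lt_floor_add_one y
    push_cast
    rw [abs_le]
    constructor
    · linarith [neg_abs_le (x - y)]
    · linarith [le_abs_self (x - y)]
  rw [← Real.exp_add, Real.exp_le_exp, ← sq_abs]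
  have h4 : q * |((⌊x⌋ - ⌊y⌋ : ℤ) : ℝ)| ≤ q * (|x - y| + 1) := by gcongr
  nlinarith [sq_nonneg (|T * (Real.log x - Real.log y)| - 1)]

namespace BeurlingSystem

variable (S : BeurlingSystem)

lemma finite_abs_sub_val_le (x lam : ℝ) : {n : ℕ →₀ ℕ | |x - S.val n| ≤ lam}.Finite :=
  (S.finite_val_le (x + lam)).subset fun n hn => by
    rw [Set.mem_ofPred_eq] at *
    linarith [(abs_le.mp hn).1]

lemma card_filter_floor_val_le_chi (s : Finset (ℕ →₀ ℕ)) (n : ℕ →₀ ℕ) :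
    ((s.filter fun m => ⌊S.val m⌋ = ⌊S.val n⌋).card : ℝ) ≤ S.chi (S.val n) 1 := by
  rw [chi, ← Set.ncard_coe_finset]
  refine Nat.cast_le.mpr (Set.ncard_le_ncard (fun m hm => ?_) (S.finite_abs_sub_val_le _ _))
  have h := (Finset.mem_filter.mp (Finset.mem_coe.mp hm)).2
  rw [Set.mem_ofPred_eq]
  exact (Int.abs_sub_lt_one_of_floor_eq_floor h.symm).le

lemma one_le_chi (n : ℕ →₀ ℕ) : 1 ≤ S.chi (S.val n) 1 := by
  refine le_trans ?_ (S.card_filter_floor_val_le_chi {n} n)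
  rw [Nat.one_le_cast, Finset.one_le_card]
  exact ⟨n, by simp⟩

lemma sum_chi_le {p x : ℝ} (hp : 1 < p) {s : Finset (ℕ →₀ ℕ)} (hs : ∀ n ∈ s, S.val n ≤ x) :
    ∑ n ∈ s, S.chi (S.val n) 1 ≤ ∑ᶠ n ∈ {n : ℕ →₀ ℕ | S.val n ≤ x}, S.chi (S.val n) 1 ^ p := by
  rw [finsum_mem_eq_finite_toFinset_sum _ (S.finite_val_le x)]
  refine (Finset.sum_le_sum fun n _ =>
    Real.self_le_rpow_of_one_le (S.one_le_chi n) hp.le).trans ?_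
  refine Finset.sum_le_sum_of_subset_of_nonneg (fun n hn => ?_) fun n _ _ =>
    Real.rpow_nonneg (zero_le_one.trans (S.one_le_chi n)) _
  rw [Set.Finite.mem_toFinset]
  exact hs n hn

lemma sum_sum_exp_neg_sq_le {p : ℝ} (hp : 1 < p) {N T : ℝ} (hN : 1 ≤ N) (hT : 1 ≤ T)
    {s : Finset (ℕ →₀ ℕ)} (hs : ∀ n ∈ s, S.val n ≤ 2 * N) :
    ∑ m ∈ s, ∑ n ∈ s, Real.exp (-(T * (Real.log (S.val m) - Real.log (S.val n))) ^ 2) ≤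
      8 * Real.exp 2 * ((T + N) / T) *
        ∑ᶠ n ∈ {n : ℕ →₀ ℕ | S.val n ≤ 2 * N}, S.chi (S.val n) 1 ^ p := by
  have hT0 : 0 < T := by linarith
  have hN0 : 0 < N := by linarith
  obtain ⟨q, hq⟩ : ∃ q, q = T / (T + 2 * N) := ⟨_, rfl⟩
  have hq0 : 0 < q := by rw [hq]; positivity
  have hq1 : q ≤ 1 := by rw [hq, div_le_one (by positivity)]; linarith
  have hq2 : q ≤ T / (2 * N) := by
    rw [hq]; exact div_le_div_of_nonneg_left hT0.le (by positivity) (by linarith)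
  have hsum0 : 0 ≤ ∑ n ∈ s, S.chi (S.val n) 1 :=
    Finset.sum_nonneg fun n _ => zero_le_one.trans (S.one_le_chi n)
  calc _ ≤ ∑ m ∈ s, ∑ n ∈ s,
        Real.exp 2 * Real.exp (-(q * |((⌊S.val m⌋ - ⌊S.val n⌋ : ℤ) : ℝ)|)) :=
        Finset.sum_le_sum fun m hm => Finset.sum_le_sum fun n hn =>
          exp_neg_sq_mul_log_sub_log_le hN0 (S.val_pos m) (S.val_pos n) (hs m hm) (hs n hn)
            hq0.le hq1 hq2
    _ = Real.exp 2 * ∑ m ∈ s, ∑ n ∈ s, Real.exp (-(q * |((⌊S.val m⌋ - ⌊S.val n⌋ : ℤ) : ℝ)|)) := by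
        simp only [Finset.mul_sum]
    _ ≤ Real.exp 2 * (4 / q * ∑ n ∈ s, S.chi (S.val n) 1) := by
        refine mul_le_mul_of_nonneg_left ?_ (Real.exp_pos _).le
        refine (sum_sum_exp_neg_mul_abs_sub_le s (fun n => ⌊S.val n⌋) hq0 hq1).trans ?_
        refine mul_le_mul_of_nonneg_left ?_ (by positivity)
        exact Finset.sum_le_sum fun n _ => S.card_filter_floor_val_le_chi s n
    _ ≤ Real.exp 2 * (8 * ((T + N) / T) * ∑ n ∈ s, S.chi (S.val n) 1) := by
        refine mul_le_mul_of_nonneg_left (mul_le_mul_of_nonneg_right ?_ hsum0) (Real.exp_pos _).le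
        rw [hq, div_div_eq_mul_div, mul_div_assoc', div_le_div_iff_of_pos_right hT0]
        linarith
    _ ≤ Real.exp 2 * (8 * ((T + N) / T) *
        ∑ᶠ n ∈ {n : ℕ →₀ ℕ | S.val n ≤ 2 * N}, S.chi (S.val n) 1 ^ p) := by
        have := S.sum_chi_le hp hs
        gcongr
    _ = _ := by ring

/-- The mean value estimate for a dyadic block of the mollified Dirichlet polynomial. -/
lemma exists_sum_norm_sq_block_le {p : ℝ} (hp : 1 < p)
    (hRam : ∀ ε : ℝ, 0 < ε → ∃ Cε : ℝ, ∀ x : ℝ, 1 ≤ x →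
      (∑ᶠ n ∈ {n : ℕ →₀ ℕ | S.val n ≤ x}, S.chi (S.val n) 1 ^ p) ≤ Cε * x ^ (1 + ε))
    {η : ℝ} (hη : 0 < η) :
    ∃ C : ℝ, 0 < C ∧ ∀ (X Z N T α W : ℝ) (s : Finset (ℕ →₀ ℕ)) (Γ : Finset ℂ), 1 ≤ N → 1 ≤ T →
      0 ≤ α → (∀ n ∈ s, N < S.val n ∧ S.val n ≤ 2 * N) →
      (∀ ρ ∈ Γ, α ≤ ρ.re ∧ ρ.re ≤ α + 1 ∧ |ρ.im| ≤ T) →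
      (∀ k : ℤ, ((Γ.filter fun ρ => ⌊ρ.im⌋ = k).card : ℝ) ≤ W) →
      ∑ ρ ∈ Γ, ‖∑ n ∈ s, (S.mollCoeff X Z n : ℂ) * (S.val n : ℂ) ^ (-ρ)‖ ^ 2 ≤
        C * W * (T + N) * N ^ (1 - 2 * α + 3 * η) := by
  obtain ⟨D, hD1, hD⟩ := S.exists_card_antidiagonal_le hη
  obtain ⟨B, hB⟩ := hRam η hη
  obtain ⟨B', hB'⟩ : ∃ B', B' = max B 1 := ⟨_, rfl⟩
  have hB'0 : 0 < B' := by rw [hB']; exact one_pos.trans_le (le_max_right _ _)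
  refine ⟨64 * Real.exp 8 * B' * D ^ 2 * 2 ^ (1 + 3 * η), by positivity,
    fun X Z N T α W s Γ hN hT hα hs hΓ hW => ?_⟩
  have hN0 : 0 < N := by linarith
  have hT0 : 0 < T := by linarith
  have hW0 : 0 ≤ W := (Nat.cast_nonneg _).trans (hW 0)
  have hterm : ∀ ρ : ℂ, ∑ n ∈ s, (S.mollCoeff X Z n : ℂ) * (S.val n : ℂ) ^ (-ρ) =
      ∑ n ∈ s, (S.mollCoeff X Z n : ℂ) * Complex.exp (-ρ * (Real.log (S.val n) : ℝ)) := by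
    intro ρ
    refine Finset.sum_congr rfl fun n _ => ?_
    rw [Complex.cpow_def_of_ne_zero (by exact_mod_cast (S.val_pos n).ne'),
      Complex.ofReal_log (S.val_pos n).le, mul_comm (Complex.log _)]
  have hlog : ∀ n ∈ s, Real.log N ≤ Real.log (S.val n) ∧
      Real.log (S.val n) ≤ Real.log N + 1 := by
    intro n hn
    obtain ⟨h1, h2⟩ := hs n hn
    refine ⟨Real.log_le_log hN0 h1.le, ?_⟩
    have h3 := Real.log_le_log (S.val_pos n) h2
    rw [Real.log_mul two_ne_zero hN0.ne'] at h3
    linarith [Real.log_two_lt_d9]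
  have hmean := sum_norm_sq_sum_exp_le s (fun n => (S.mollCoeff X Z n : ℂ))
    (fun n => Real.log (S.val n)) (Real.log_nonneg hN) hlog hT Γ hΓ hW
  have hcoef : ∀ n ∈ s, ‖(S.mollCoeff X Z n : ℂ)‖ * Real.exp (-(α * Real.log (S.val n))) ≤
      D * (2 * N) ^ η * N ^ (-α) := by
    intro n hn
    obtain ⟨h1, h2⟩ := hs n hn
    have hv := S.val_pos n
    refine mul_le_mul ?_ ?_ (Real.exp_pos _).le (by positivity)
    · rw [Complex.norm_real, Real.norm_eq_abs]
      refine (S.abs_mollCoeff_le X Z n).trans ((hD n).trans ?_)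
      gcongr
    · rw [← mul_neg_one, mul_right_comm, mul_neg_one, mul_comm, ← Real.rpow_def_of_pos hv]
      exact Real.rpow_le_rpow_of_nonpos hN0 h1.le (by linarith)
  have hquad : ∑ m ∈ s, ∑ n ∈ s,
      (‖(S.mollCoeff X Z m : ℂ)‖ * Real.exp (-(α * Real.log (S.val m)))) *
        (‖(S.mollCoeff X Z n : ℂ)‖ * Real.exp (-(α * Real.log (S.val n)))) *
          Real.exp (-(T * (Real.log (S.val m) - Real.log (S.val n))) ^ 2) ≤
      (D * (2 * N) ^ η * N ^ (-α)) ^ 2 *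
        (8 * Real.exp 2 * ((T + N) / T) * (B' * (2 * N) ^ (1 + η))) := by
    calc _ ≤ ∑ m ∈ s, ∑ n ∈ s, (D * (2 * N) ^ η * N ^ (-α)) * (D * (2 * N) ^ η * N ^ (-α)) *
          Real.exp (-(T * (Real.log (S.val m) - Real.log (S.val n))) ^ 2) := by
          refine Finset.sum_le_sum fun m hm => Finset.sum_le_sum fun n hn => ?_
          exact mul_le_mul_of_nonneg_right (mul_le_mul (hcoef m hm) (hcoef n hn) (by positivity)
            (by positivity)) (Real.exp_pos _).le
      _ = (D * (2 * N) ^ η * N ^ (-α)) ^ 2 * ∑ m ∈ s, ∑ n ∈ s,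
          Real.exp (-(T * (Real.log (S.val m) - Real.log (S.val n))) ^ 2) := by
          simp only [Finset.mul_sum, sq]
      _ ≤ _ := by
          refine mul_le_mul_of_nonneg_left ?_ (sq_nonneg _)
          refine (S.sum_sum_exp_neg_sq_le hp hN hT fun n hn => (hs n hn).2).trans ?_
          refine mul_le_mul_of_nonneg_left ((hB _ (by linarith)).trans ?_) (by positivity)
          refine mul_le_mul_of_nonneg_right ?_ (by positivity)
          rw [hB']; exact le_max_left _ _
  simp only [hterm]
  refine hmean.trans ?_
  calc _ ≤ 8 * Real.exp 6 * W * T * ((D * (2 * N) ^ η * N ^ (-α)) ^ 2 *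
        (8 * Real.exp 2 * ((T + N) / T) * (B' * (2 * N) ^ (1 + η)))) := by gcongr
    _ = _ := by
      have h1 : Real.exp 8 = Real.exp 6 * Real.exp 2 := by rw [← Real.exp_add]; norm_num
      have h2 : (2 : ℝ) ^ (1 + 3 * η) = 2 ^ η * 2 ^ η * 2 ^ (1 + η) := by
        rw [← Real.rpow_add two_pos, ← Real.rpow_add two_pos]; congr 1; ring
      have h3 : N ^ (1 - 2 * α + 3 * η) = N ^ η * N ^ η * N ^ (1 + η) * N ^ (-α) * N ^ (-α) := by
        simp only [← Real.rpow_add hN0]; congr 1; ring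
      rw [h1, h2, h3, Real.mul_rpow two_pos.le hN0.le, Real.mul_rpow two_pos.le hN0.le]
      field_simp
      ring

end BeurlingSystem

lemma sum_filter_lt_le_eq_sum_range_dyadic {ι M : Type*} [AddCommMonoid M] (s : Finset ι)
    (v : ι → ℝ) (f : ι → M) {X : ℝ} (hX : 0 ≤ X) (J : ℕ) :
    ∑ n ∈ s.filter (fun n => X < v n ∧ v n ≤ X * 2 ^ J), f n =
      ∑ j ∈ Finset.range J,
        ∑ n ∈ s.filter (fun n => X * 2 ^ j < v n ∧ v n ≤ X * 2 ^ (j + 1)), f n := by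
  classical
  induction J with
  | zero =>
    rw [Finset.range_zero, Finset.sum_empty, Finset.filter_false_of_mem, Finset.sum_empty]
    intro n _ h
    rw [pow_zero, mul_one] at h
    linarith [h.1, h.2]
  | succ J ih =>
    have h1 : X ≤ X * 2 ^ J := le_mul_of_one_le_right hX (one_le_pow₀ one_le_two)
    have h2 : X * 2 ^ J ≤ X * 2 ^ (J + 1) := by rw [pow_succ, ← mul_assoc]; nlinarith
    rw [Finset.sum_range_succ, ← ih, ← Finset.sum_union]
    · refine Finset.sum_congr ?_ fun _ _ => rfl
      ext n
      simp only [Finset.mem_union, Finset.mem_filter]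
      constructor
      · rintro ⟨hn, h3, h4⟩
        rcases le_or_gt (v n) (X * 2 ^ J) with h5 | h5
        · exact Or.inl ⟨hn, h3, h5⟩
        · exact Or.inr ⟨hn, h5, h4⟩
      · rintro (⟨hn, h3, h4⟩ | ⟨hn, h3, h4⟩)
        · exact ⟨hn, h3, h4.trans h2⟩
        · exact ⟨hn, h1.trans_lt h3, h4⟩
    · refine Finset.disjoint_filter.mpr fun n _ h3 h4 => ?_
      linarith [h3.2, h4.1]

lemma exists_add_one_le_rpow {η : ℝ} (hη : 0 < η) :
    ∃ C : ℝ, 0 < C ∧ ∀ (n : ℕ) (Z : ℝ), (2 : ℝ) ^ n ≤ Z → (n : ℝ) + 1 ≤ C * Z ^ η := by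
  have h1 : 1 < (2 : ℝ) ^ η := Real.one_lt_rpow one_lt_two hη
  obtain ⟨w, hw⟩ : ∃ w, w = (2 : ℝ) ^ η - 1 := ⟨_, rfl⟩
  have hw0 : 0 < w := by linarith
  refine ⟨1 + 1 / w, by positivity, fun n Z hZ => ?_⟩
  have h2 : 1 + (n : ℝ) * w ≤ (1 + w) ^ n := one_add_mul_le_pow (by linarith) n
  have h3 : (1 + w) ^ n ≤ Z ^ η := by
    rw [show 1 + w = (2 : ℝ) ^ η by rw [hw]; ring, Real.rpow_pow_comm two_pos.le]
    exact Real.rpow_le_rpow (by positivity) hZ hη.le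
  have hn : (0 : ℝ) ≤ n := n.cast_nonneg
  calc (n : ℝ) + 1 ≤ (1 + 1 / w) * (1 + n * w) := by
        have : (1 + 1 / w) * (1 + n * w) = n + 1 + (n * w + 1 / w) := by field_simp; ring
        rw [this]
        have : 0 ≤ n * w + 1 / w := by positivity
        linarith
    _ ≤ _ := by gcongr; exact h2.trans h3

lemma Finset.card_filter_abs_im_le (Γ : Finset ℂ) {W V : ℝ}
    (hW : ∀ k : ℤ, ((Γ.filter fun ρ => ⌊ρ.im⌋ = k).card : ℝ) ≤ W) (hV : 0 ≤ V) :
    ((Γ.filter fun ρ => |ρ.im| ≤ V).card : ℝ) ≤ W * (2 * V + 2) := by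
  classical
  have hW0 : 0 ≤ W := (Nat.cast_nonneg _).trans (hW 0)
  have h1 : (Γ.filter fun ρ => |ρ.im| ≤ V).card =
      ∑ k ∈ Finset.Icc ⌊-V⌋ ⌊V⌋, ((Γ.filter fun ρ => |ρ.im| ≤ V).filter
        fun ρ => ⌊ρ.im⌋ = k).card :=
    Finset.card_eq_sum_card_fiberwise fun ρ hρ => by
      have := abs_le.mp (Finset.mem_filter.mp (Finset.mem_coe.mp hρ)).2
      exact Finset.mem_coe.mpr (Finset.mem_Icc.mpr ⟨Int.floor_mono this.1, Int.floor_mono this.2⟩)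
  rw [h1, Nat.cast_sum]
  calc _ ≤ ∑ k ∈ Finset.Icc ⌊-V⌋ ⌊V⌋, W := by
        refine Finset.sum_le_sum fun k _ => le_trans (Nat.cast_le.mpr (Finset.card_le_card ?_)) (hW k)
        exact Finset.filter_subset_filter _ (Finset.filter_subset _ _)
    _ = ((⌊V⌋ + 1 - ⌊-V⌋).toNat : ℝ) * W := by
        rw [Finset.sum_const, nsmul_eq_mul, Int.card_Icc]
    _ ≤ (2 * V + 2) * W := by
        refine mul_le_mul_of_nonneg_right ?_ hW0
        have h2 := Int.floor_le V
        have h3 := Int.lt_floor_add_one (-V)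
        have h4 : ⌊-V⌋ ≤ ⌊V⌋ := Int.floor_mono (by linarith)
        have h5 : (((⌊V⌋ + 1 - ⌊-V⌋).toNat : ℤ) : ℝ) = ((⌊V⌋ + 1 - ⌊-V⌋ : ℤ) : ℝ) := by
          rw [Int.toNat_of_nonneg (by omega)]
        rw [Int.cast_natCast] at h5
        rw [h5]
        push_cast
        linarith
    _ = _ := mul_comm _ _

namespace BeurlingSystem

variable {S : BeurlingSystem} {A θ K₀ : ℝ} {ζ : ℂ → ℂ}

lemma IsZeta.exists_card_cell_le (hζ : S.IsZeta θ ζ) (h : S.WellBehaved A θ K₀) {α₀ : ℝ}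
    (hα : θ < α₀) (hα1 : α₀ ≤ 1) {η : ℝ} (hη : 0 < η) :
    ∃ C : ℝ, 0 < C ∧ ∀ (T : ℝ) (Γ : Finset ℂ), 1 ≤ T →
      (∀ ρ ∈ Γ, ζ ρ = 0 ∧ ρ ≠ 1 ∧ α₀ ≤ ρ.re ∧ ρ.re ≤ 1 ∧ |ρ.im| ≤ T) →
      ∀ k : ℤ, ((Γ.filter fun ρ => ⌊ρ.im⌋ = k).card : ℝ) ≤ C * T ^ η := by
  obtain ⟨C, hC, hcard⟩ := hζ.exists_card_zeros_le h hα hα1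
  refine ⟨C * (1 + 4 ^ η / η), by positivity, fun T Γ hT hΓ k => ?_⟩
  rcases (Γ.filter fun ρ => ⌊ρ.im⌋ = k).eq_empty_or_nonempty with he | ⟨ρ₀, hρ₀⟩
  · rw [he, Finset.card_empty, Nat.cast_zero]
    positivity
  obtain ⟨hρ₀, hk⟩ := Finset.mem_filter.mp hρ₀
  have hfloor : ∀ ρ : ℂ, ⌊ρ.im⌋ = k → |ρ.im - k| ≤ 1 := by
    intro ρ hρ
    have h1 := Int.floor_le ρ.im
    have h2 := Int.lt_floor_add_one ρ.im
    rw [hρ] at h1 h2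
    rw [abs_le]
    constructor <;> linarith
  have hkT : |(k : ℝ)| ≤ T + 1 := by
    have h1 := hfloor ρ₀ hk
    have h2 := (hΓ ρ₀ hρ₀).2.2.2.2
    have h3 := abs_sub_abs_le_abs_sub (k : ℝ) ρ₀.im
    rw [abs_sub_comm] at h3
    linarith
  have h1 := hcard k (Γ.filter fun ρ => ⌊ρ.im⌋ = k) fun ρ hρ => by
    obtain ⟨hρ, hρk⟩ := Finset.mem_filter.mp hρ
    obtain ⟨a1, a2, a3, a4, -⟩ := hΓ ρ hρ
    exact ⟨a1, a2, a3, a4, hfloor ρ hρk⟩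
  refine h1.trans ?_
  rw [mul_assoc]
  refine mul_le_mul_of_nonneg_left ?_ hC.le
  have h2 : Real.log (2 + |(k : ℝ)|) ≤ Real.log (4 * T) :=
    Real.log_le_log (by positivity) (by linarith)
  have h3 := Real.log_le_rpow_div (x := 4 * T) (by linarith) hη
  rw [Real.mul_rpow (by norm_num) (by linarith)] at h3
  have h4 := Real.one_le_rpow hT hη.le
  calc _ ≤ T ^ η + 4 ^ η * T ^ η / η := by linarith
    _ = _ := by ring

/-- The number of points at which a mollified Dirichlet polynomial is large. -/
lemma exists_card_large_values_le (S : BeurlingSystem) {p : ℝ} (hp : 1 < p)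
    (hRam : ∀ ε : ℝ, 0 < ε → ∃ Cε : ℝ, ∀ x : ℝ, 1 ≤ x →
      (∑ᶠ n ∈ {n : ℕ →₀ ℕ | S.val n ≤ x}, S.chi (S.val n) 1 ^ p) ≤ Cε * x ^ (1 + ε))
    {η : ℝ} (hη : 0 < η) :
    ∃ C : ℝ, 0 < C ∧ ∀ (X Z T α W : ℝ) (Γ : Finset ℂ), 1 ≤ X → 1 ≤ Z → 1 ≤ T →
      1 / 2 ≤ α → α ≤ 1 → (∀ ρ ∈ Γ, α ≤ ρ.re ∧ ρ.re ≤ α + 1 ∧ |ρ.im| ≤ T) →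
      (∀ k : ℤ, ((Γ.filter fun ρ => ⌊ρ.im⌋ = k).card : ℝ) ≤ W) →
      (∀ ρ ∈ Γ, 1 / 2 ≤ ‖∑ n ∈ (S.upTo (X * Z)).filter (fun n => X < S.val n),
        (S.mollCoeff X Z n : ℂ) * (S.val n : ℂ) ^ (-ρ)‖) →
      (Γ.card : ℝ) ≤
        C * W * (X * Z) ^ (5 * η) * (T * X ^ (1 - 2 * α) + (X * Z) ^ (2 - 2 * α)) := by
  classical
  obtain ⟨C₁, hC₁, hblock⟩ := S.exists_sum_norm_sq_block_le hp hRam hη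
  obtain ⟨C₂, hC₂, hlog⟩ := exists_add_one_le_rpow hη
  refine ⟨4 * C₂ ^ 2 * C₁, by positivity, fun X Z T α W Γ hX hZ hT hα hα1 hΓ hW hlarge => ?_⟩
  have hX0 : 0 < X := by linarith
  have hW0 : 0 ≤ W := (Nat.cast_nonneg _).trans (hW 0)
  obtain ⟨k, hk, hk1⟩ := exists_nat_pow_near hZ one_lt_two
  obtain ⟨Y, hY⟩ : ∃ Y, Y = X * Z := ⟨_, rfl⟩
  have hZY : Z ≤ Y := by rw [hY]; exact le_mul_of_one_le_left (by linarith) hX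
  have hY1 : 1 ≤ Y := hZ.trans hZY
  have hY0 : 0 < Y := by linarith
  obtain ⟨J, hJ⟩ : ∃ J, J = k + 1 := ⟨_, rfl⟩
  have hJlog : (J : ℝ) ≤ C₂ * Y ^ η := by
    rw [hJ, Nat.cast_add_one]
    exact (hlog k Z hk).trans (by gcongr)
  obtain ⟨F, hF⟩ : ∃ F : ℕ → ℂ → ℂ, ∀ j ρ, F j ρ =
      ∑ n ∈ (S.upTo Y).filter (fun n => X * 2 ^ j < S.val n ∧ S.val n ≤ X * 2 ^ (j + 1)),
        (S.mollCoeff X Z n : ℂ) * (S.val n : ℂ) ^ (-ρ) := ⟨_, fun _ _ => rfl⟩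
  have hsplit : ∀ ρ : ℂ, ∑ n ∈ (S.upTo Y).filter (fun n => X < S.val n),
      (S.mollCoeff X Z n : ℂ) * (S.val n : ℂ) ^ (-ρ) = ∑ j ∈ Finset.range J, F j ρ := by
    intro ρ
    simp only [hF]
    rw [← sum_filter_lt_le_eq_sum_range_dyadic _ _ _ hX0.le]
    refine Finset.sum_congr (Finset.filter_congr fun n hn => ?_) fun _ _ => rfl
    refine ⟨fun h1 => ⟨h1, (S.mem_upTo.mp hn).trans ?_⟩, And.left⟩
    rw [hY, hJ]
    gcongr
  have hpt : ∀ ρ ∈ Γ, 1 ≤ 4 * J * ∑ j ∈ Finset.range J, ‖F j ρ‖ ^ 2 := by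
    intro ρ hρ
    have h1 := hlarge ρ hρ
    rw [← hY, hsplit] at h1
    have h2 := h1.trans (norm_sum_le _ _)
    have h3 := sq_sum_le_card_mul_sum_sq (s := Finset.range J) (f := fun j => ‖F j ρ‖)
    rw [Finset.card_range] at h3
    have h4 := pow_le_pow_left₀ (by norm_num) h2 2
    linarith
  have hj : ∀ j ∈ Finset.range J, ∑ ρ ∈ Γ, ‖F j ρ‖ ^ 2 ≤
      C₁ * W * (Y ^ (3 * η) * (T * X ^ (1 - 2 * α) + Y ^ (2 - 2 * α))) := by
    intro j hj
    obtain ⟨N, hN⟩ : ∃ N, N = X * 2 ^ j := ⟨_, rfl⟩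
    have hXN : X ≤ N := by rw [hN]; exact le_mul_of_one_le_right hX0.le (one_le_pow₀ one_le_two)
    have hNY : N ≤ Y := by
      rw [hN, hY]
      refine mul_le_mul_of_nonneg_left ?_ hX0.le
      refine (pow_le_pow_right₀ one_le_two ?_).trans hk
      have := Finset.mem_range.mp hj
      omega
    have hN1 : 1 ≤ N := hX.trans hXN
    have hN0 : 0 < N := by linarith
    have h1 := hblock X Z N T α W
      ((S.upTo Y).filter (fun n => X * 2 ^ j < S.val n ∧ S.val n ≤ X * 2 ^ (j + 1))) Γ hN1 hT
      (by linarith) (fun n hn => by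
        have := (Finset.mem_filter.mp hn).2
        rw [hN]
        refine ⟨this.1, this.2.trans_eq ?_⟩
        ring) hΓ hW
    simp only [← hF] at h1
    refine h1.trans ?_
    rw [mul_assoc (C₁ * W)]
    refine mul_le_mul_of_nonneg_left ?_ (by positivity)
    have h2 : N ^ (3 * η) ≤ Y ^ (3 * η) := Real.rpow_le_rpow hN0.le hNY (by positivity)
    have h3 : N ^ (1 - 2 * α) ≤ X ^ (1 - 2 * α) :=
      Real.rpow_le_rpow_of_nonpos hX0 hXN (by linarith)
    have h4 : N ^ (2 - 2 * α) ≤ Y ^ (2 - 2 * α) := Real.rpow_le_rpow hN0.le hNY (by linarith)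
    have h5 : N ^ (2 - 2 * α) = N * N ^ (1 - 2 * α) := by
      rw [show 2 - 2 * α = 1 + (1 - 2 * α) by ring, Real.rpow_add hN0, Real.rpow_one]
    calc (T + N) * N ^ (1 - 2 * α + 3 * η) =
          N ^ (3 * η) * (T * N ^ (1 - 2 * α) + N ^ (2 - 2 * α)) := by
          rw [h5, Real.rpow_add hN0]; ring
      _ ≤ _ := by gcongr
  obtain ⟨Q, hQ⟩ : ∃ Q, Q = T * X ^ (1 - 2 * α) + Y ^ (2 - 2 * α) := ⟨_, rfl⟩
  have hQ0 : 0 ≤ Q := by rw [hQ]; positivity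
  rw [← hQ] at hj
  rw [← hY, ← hQ]
  calc (Γ.card : ℝ) = ∑ ρ ∈ Γ, 1 := by simp
    _ ≤ ∑ ρ ∈ Γ, 4 * J * ∑ j ∈ Finset.range J, ‖F j ρ‖ ^ 2 := Finset.sum_le_sum hpt
    _ = 4 * J * ∑ j ∈ Finset.range J, ∑ ρ ∈ Γ, ‖F j ρ‖ ^ 2 := by
        rw [← Finset.mul_sum, Finset.sum_comm]
    _ ≤ 4 * J * (J * (C₁ * W * (Y ^ (3 * η) * Q))) := by
        refine mul_le_mul_of_nonneg_left ((Finset.sum_le_sum hj).trans_eq ?_) (by positivity)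
        rw [Finset.sum_const, Finset.card_range, nsmul_eq_mul]
    _ ≤ 4 * (C₂ * Y ^ η) * ((C₂ * Y ^ η) * (C₁ * W * (Y ^ (3 * η) * Q))) := by gcongr
    _ = _ := by
        have h1 : Y ^ (5 * η) = Y ^ η * Y ^ η * Y ^ (3 * η) := by
          rw [← Real.rpow_add hY0, ← Real.rpow_add hY0]; congr 1; ring
        rw [h1]
        ring

end BeurlingSystem

/-- The choice of mollifier lengths `X = T ^ a` and `Z = T ^ b` (up to `T ^ ε`) balancing the two
terms in the large values estimate. -/
lemma exists_balanced_exponents {θ α : ℝ} (hθ0 : 0 ≤ θ) (hθ : θ < 1) (hα : (θ + 2) / 3 ≤ α)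
    (hα1 : α ≤ 1) {e : ℝ}
    (he : e = (1 - α) * (4 * α - 2 * θ) / (2 * α ^ 2 - 3 * α + 2 - θ)) :
    ∃ a b : ℝ, 0 ≤ a ∧ a ≤ 1 ∧ a ≤ b ∧ a + b ≤ 3 / (1 - θ) ∧ (1 - α) * (a + b) = e / 2 ∧
      (1 - α) * a + (θ - α) * b + 1 = 0 ∧ 1 + (1 - 2 * α) * a = e ∧ 0 ≤ e := by
  obtain ⟨D, hD⟩ : ∃ D, D = 2 * α ^ 2 - 3 * α + 2 - θ := ⟨_, rfl⟩
  have hD1 : 2 / 3 * (1 - θ) ≤ D := by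
    rw [hD]; nlinarith [sq_nonneg (α - (θ + 2) / 3 - (1 - θ) / 3)]
  have hD0 : 0 < D := by linarith
  have hne : D ≠ 0 := hD0.ne'
  rw [← hD] at he
  refine ⟨(3 * α - 2 - θ) / D, (2 - α) / D, div_nonneg (by linarith) hD0.le, ?_, ?_, ?_, ?_, ?_,
    ?_, ?_⟩
  · rw [div_le_one hD0, hD]; nlinarith
  · exact div_le_div_of_nonneg_right (by linarith) hD0.le
  · rw [← add_div, div_le_div_iff₀ hD0 (by linarith)]
    nlinarith [mul_nonneg (show (0 : ℝ) ≤ 2 - (2 * α - θ) by linarith) (sub_nonneg.mpr hθ.le)]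
  · rw [he]; field_simp; ring
  · field_simp; rw [hD]; ring
  · rw [he]; field_simp; rw [hD]; ring
  · rw [he]; exact div_nonneg (mul_nonneg (by linarith) (by linarith)) hD0.le

namespace BeurlingSystem

variable {S : BeurlingSystem} {A θ K₀ : ℝ} {ζ : ℂ → ℂ}

lemma mollified_error_le {T a b α e ε B : ℝ} (hA : 0 ≤ A) (hK : 0 ≤ K₀) (hB : 0 ≤ B)
    (hθ1 : θ < 1) (hθ0 : 0 ≤ θ) (hα : (θ + 2) / 3 ≤ α)
    (ha1 : a ≤ 1) (hab : (1 - α) * (a + b) = e / 2)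
    (hab1 : (1 - α) * a + (θ - α) * b + 1 = 0) (hε : 0 < ε) (hT : 1 ≤ T) {ρ : ℂ}
    (hre0 : 0 ≤ ρ.re) (hre : ρ.re ≤ 1) (hT' : |ρ.im| ≤ T)
    (hV : T ^ (e / 2 + 2 * ε) < |ρ.im|) :
    (B * (T ^ a) ^ (1 - α + ε * (1 - θ) / 3)) *
      (A * (T ^ (b + ε)) ^ (1 - α) / ‖ρ - 1‖ +
        K₀ * (T ^ (b + ε)) ^ (θ - α) * (1 + ‖ρ‖ / (α - θ))) ≤
      B * (A + K₀ * (1 + 3 / (1 - θ))) * T ^ (-(ε * (1 - θ) / 3)) := by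
  have hT0 : 0 < T := by linarith
  have hℓ : 0 < 1 - θ := by linarith
  have hαθ : 2 / 3 * (1 - θ) ≤ α - θ := by linarith
  have hαθ0 : 0 < α - θ := by linarith
  have h1 : T ^ (e / 2 + 2 * ε) ≤ ‖ρ - 1‖ := by
    have := Complex.abs_im_le_norm (ρ - 1)
    simp only [Complex.sub_im, Complex.one_im, sub_zero] at this
    linarith
  have h2 : 1 + ‖ρ‖ / (α - θ) ≤ T * (1 + 3 / (1 - θ)) := by
    have h3 : ‖ρ‖ ≤ 2 * T := by
      have := Complex.norm_le_abs_re_add_abs_im ρ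
      rw [abs_of_nonneg hre0] at this
      linarith
    have h4 : ‖ρ‖ / (α - θ) ≤ 2 * T / (2 / 3 * (1 - θ)) := by gcongr
    have h5 : 2 * T / (2 / 3 * (1 - θ)) = T * (3 / (1 - θ)) := by field_simp
    linarith
  have hV0 : 0 < T ^ (e / 2 + 2 * ε) := by positivity
  have hε' : ε * (1 - θ) / 3 * a ≤ ε * (1 - θ) / 3 := mul_le_of_le_one_right (by positivity) ha1
  have h6 : (T ^ a) ^ (1 - α + ε * (1 - θ) / 3) * ((T ^ (b + ε)) ^ (1 - α) / ‖ρ - 1‖) ≤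
      T ^ (-(ε * (1 - θ) / 3)) := by
    calc _ ≤ (T ^ a) ^ (1 - α + ε * (1 - θ) / 3) *
          ((T ^ (b + ε)) ^ (1 - α) / T ^ (e / 2 + 2 * ε)) := by gcongr
      _ = T ^ (a * (1 - α + ε * (1 - θ) / 3) + ((b + ε) * (1 - α) - (e / 2 + 2 * ε))) := by
          rw [← Real.rpow_mul hT0.le, ← Real.rpow_mul hT0.le, ← Real.rpow_sub hT0,
            ← Real.rpow_add hT0]
      _ ≤ _ := Real.rpow_le_rpow_of_exponent_le hT (by nlinarith)
  have h7 : (T ^ a) ^ (1 - α + ε * (1 - θ) / 3) * ((T ^ (b + ε)) ^ (θ - α) * T) ≤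
      T ^ (-(ε * (1 - θ) / 3)) := by
    calc _ = T ^ (a * (1 - α + ε * (1 - θ) / 3) + ((b + ε) * (θ - α) + 1)) := by
          rw [← Real.rpow_mul hT0.le, ← Real.rpow_mul hT0.le, Real.rpow_add hT0,
            Real.rpow_add hT0 (_ * (θ - α)), Real.rpow_one]
      _ ≤ _ := Real.rpow_le_rpow_of_exponent_le hT (by nlinarith)
  calc _ ≤ (B * (T ^ a) ^ (1 - α + ε * (1 - θ) / 3)) *
      (A * (T ^ (b + ε)) ^ (1 - α) / ‖ρ - 1‖ +
        K₀ * (T ^ (b + ε)) ^ (θ - α) * (T * (1 + 3 / (1 - θ)))) := by gcongr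
    _ = B * (A * ((T ^ a) ^ (1 - α + ε * (1 - θ) / 3) *
          ((T ^ (b + ε)) ^ (1 - α) / ‖ρ - 1‖)) + K₀ * (1 + 3 / (1 - θ)) *
          ((T ^ a) ^ (1 - α + ε * (1 - θ) / 3) * ((T ^ (b + ε)) ^ (θ - α) * T))) := by ring
    _ ≤ B * (A * T ^ (-(ε * (1 - θ) / 3)) + K₀ * (1 + 3 / (1 - θ)) *
          T ^ (-(ε * (1 - θ) / 3))) := by gcongr
    _ = _ := by ring

/-- The zero density estimate, for arbitrary finite sets of zeros. -/
lemma IsZeta.exists_card_zeros_le_rpow (hζ : S.IsZeta θ ζ) (h : S.WellBehaved A θ K₀) {p : ℝ}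
    (hp : 1 < p)
    (hRam : ∀ ε : ℝ, 0 < ε → ∃ Cε : ℝ, ∀ x : ℝ, 1 ≤ x →
      (∑ᶠ n ∈ {n : ℕ →₀ ℕ | S.val n ≤ x}, S.chi (S.val n) 1 ^ p) ≤ Cε * x ^ (1 + ε))
    {ε : ℝ} (hε : 0 < ε) :
    ∃ T₀ C : ℝ, 1 ≤ T₀ ∧ 0 < C ∧ ∀ (T α : ℝ) (Γ : Finset ℂ), T₀ ≤ T → (θ + 2) / 3 ≤ α → α ≤ 1 →
      (∀ ρ ∈ Γ, ζ ρ = 0 ∧ ρ ≠ 1 ∧ α ≤ ρ.re ∧ ρ.re ≤ 1 ∧ |ρ.im| ≤ T) →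
      (Γ.card : ℝ) ≤
        C * T ^ ((1 - α) * (4 * α - 2 * θ) / (2 * α ^ 2 - 3 * α + 2 - θ) + ε) := by
  classical
  have hA := h.1
  have hθ0 := h.2.1
  have hθ1 := h.2.2.1
  have hK := h.2.2.2.1
  have hℓ : 0 < 1 - θ := by linarith
  obtain ⟨ε₁, hε₁⟩ : ∃ ε₁, ε₁ = min 1 (ε / 4) := ⟨_, rfl⟩
  have hε₁0 : 0 < ε₁ := by rw [hε₁]; positivity
  have hε₁1 : ε₁ ≤ 1 := by rw [hε₁]; exact min_le_left _ _
  have hε₁ε : ε₁ ≤ ε / 4 := by rw [hε₁]; exact min_le_right _ _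
  obtain ⟨L, hL⟩ : ∃ L, L = 3 / (1 - θ) + 1 := ⟨_, rfl⟩
  have hL0 : 0 < L := by rw [hL]; positivity
  obtain ⟨η, hη⟩ : ∃ η, η = ε / 2 / (1 + 5 * L) := ⟨_, rfl⟩
  have hη0 : 0 < η := by rw [hη]; positivity
  have hηL : η + L * (5 * η) = ε / 2 := by rw [hη]; field_simp
  obtain ⟨C₁, hC₁, hcell⟩ :=
    hζ.exists_card_cell_le h (α₀ := (θ + 2) / 3) (by linarith) (by linarith) hη0
  obtain ⟨C₂, hC₂, hlarge⟩ := S.exists_card_large_values_le hp hRam hη0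
  obtain ⟨B, hB⟩ : ∃ B, B = ∑' n, S.val n ^ (-(1 + ε₁ * (1 - θ) / 3)) := ⟨_, rfl⟩
  have hB0 : 0 ≤ B := by
    rw [hB]; exact tsum_nonneg fun n => Real.rpow_nonneg (S.val_pos n).le _
  have hlim : Tendsto (fun T : ℝ => B * (A + K₀ * (1 + 3 / (1 - θ))) *
      T ^ (-(ε₁ * (1 - θ) / 3))) atTop (𝓝 0) := by
    simpa using (tendsto_rpow_neg_atTop (y := ε₁ * (1 - θ) / 3) (by positivity)).const_mul
      (B * (A + K₀ * (1 + 3 / (1 - θ))))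
  obtain ⟨T₁, hT₁⟩ :=
    (hlim.eventually_le_const (show (0 : ℝ) < 1 / 2 by norm_num)).exists_forall_of_atTop
  refine ⟨max 1 T₁, 4 * C₁ + 2 * C₂ * C₁, le_max_left _ _, by positivity,
    fun T α Γ hT hα hα1 hΓ => ?_⟩
  have hT1 : 1 ≤ T := (le_max_left _ _).trans hT
  have hT0 : 0 < T := by linarith
  obtain ⟨e, he⟩ : ∃ e, e = (1 - α) * (4 * α - 2 * θ) / (2 * α ^ 2 - 3 * α + 2 - θ) := ⟨_, rfl⟩
  obtain ⟨a, b, ha0, ha1, hab, habL, h1, h2, h3, he0⟩ := exists_balanced_exponents hθ0 hθ1 hα hα1 he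
  rw [← he]
  have hW := hcell T Γ hT1 fun ρ hρ =>
    ⟨(hΓ ρ hρ).1, (hΓ ρ hρ).2.1, hα.trans (hΓ ρ hρ).2.2.1, (hΓ ρ hρ).2.2.2.1, (hΓ ρ hρ).2.2.2.2⟩
  obtain ⟨V, hV⟩ : ∃ V, V = T ^ (e / 2 + 2 * ε₁) := ⟨_, rfl⟩
  have hV1 : 1 ≤ V := by rw [hV]; exact Real.one_le_rpow hT1 (by positivity)
  have hVle : V ≤ T ^ (e + 2 * ε₁) := by
    rw [hV]; exact Real.rpow_le_rpow_of_exponent_le hT1 (by linarith)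
  have hlow := Γ.card_filter_abs_im_le hW (V := V) (by linarith)
  have hlow' : ((Γ.filter fun ρ => |ρ.im| ≤ V).card : ℝ) ≤ 4 * C₁ * T ^ (e + ε) := by
    calc _ ≤ C₁ * T ^ η * (2 * V + 2) := hlow
      _ ≤ C₁ * T ^ η * (4 * T ^ (e + 2 * ε₁)) := by gcongr; linarith
      _ = 4 * C₁ * T ^ (η + (e + 2 * ε₁)) := by rw [Real.rpow_add hT0 η]; ring
      _ ≤ _ := mul_le_mul_of_nonneg_left (Real.rpow_le_rpow_of_exponent_le hT1 (by nlinarith))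
          (by positivity)
  have hX1 : 1 ≤ T ^ a := Real.one_le_rpow hT1 ha0
  have hXZ : T ^ a ≤ T ^ (b + ε₁) := Real.rpow_le_rpow_of_exponent_le hT1 (by linarith)
  have hY : T ^ a * T ^ (b + ε₁) = T ^ (a + b + ε₁) := by rw [← Real.rpow_add hT0, add_assoc]
  have hhigh := hlarge (T ^ a) (T ^ (b + ε₁)) T α (C₁ * T ^ η) (Γ.filter fun ρ => ¬ |ρ.im| ≤ V)
    hX1 (hX1.trans hXZ) hT1 (by linarith) hα1
    (fun ρ hρ => by
      have := hΓ ρ (Finset.mem_filter.mp hρ).1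
      exact ⟨this.2.2.1, by linarith, this.2.2.2.2⟩)
    (fun k => le_trans (Nat.cast_le.mpr (Finset.card_le_card
      (Finset.filter_subset_filter _ (Finset.filter_subset _ _)))) (hW k))
    (fun ρ hρ => by
      obtain ⟨hρΓ, hρV⟩ := Finset.mem_filter.mp hρ
      obtain ⟨hz, hne, hre, hre1, him⟩ := hΓ ρ hρΓ
      refine hζ.half_le_norm_sum_mollCoeff h (η := ε₁ * (1 - θ) / 3) hX1 hXZ hα1 (by linarith)
        (by positivity) hre hne hz ?_
      rw [← hB]
      exact (mollified_error_le hA.le hK hB0 hθ1 hθ0 hα ha1 h1 h2 hε₁0 hT1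
        (by linarith) hre1 him (by rw [← hV]; exact not_le.mp hρV)).trans
        (hT₁ T ((le_max_right _ _).trans hT)))
  have hhigh' : ((Γ.filter fun ρ => ¬ |ρ.im| ≤ V).card : ℝ) ≤ 2 * C₂ * C₁ * T ^ (e + ε) := by
    refine hhigh.trans ?_
    rw [hY]
    have h4 : T * (T ^ a) ^ (1 - 2 * α) ≤ T ^ (e + 2 * ε₁) := by
      calc _ = T ^ (1 + a * (1 - 2 * α)) := by
            rw [Real.rpow_add hT0, Real.rpow_one, Real.rpow_mul hT0.le]
        _ ≤ _ := Real.rpow_le_rpow_of_exponent_le hT1 (by linarith)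
    have h5 : (T ^ (a + b + ε₁)) ^ (2 - 2 * α) ≤ T ^ (e + 2 * ε₁) := by
      rw [← Real.rpow_mul hT0.le]
      exact Real.rpow_le_rpow_of_exponent_le hT1 (by nlinarith)
    have h6 : (T ^ (a + b + ε₁)) ^ (5 * η) ≤ T ^ (L * (5 * η)) := by
      rw [← Real.rpow_mul hT0.le]
      exact Real.rpow_le_rpow_of_exponent_le hT1
        (mul_le_mul_of_nonneg_right (by linarith) (by positivity))
    calc _ ≤ C₂ * (C₁ * T ^ η) * T ^ (L * (5 * η)) *
          (T ^ (e + 2 * ε₁) + T ^ (e + 2 * ε₁)) := by gcongr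
      _ = 2 * C₂ * C₁ * T ^ (η + L * (5 * η) + (e + 2 * ε₁)) := by
          rw [Real.rpow_add hT0 (_ + _), Real.rpow_add hT0 η]; ring
      _ ≤ _ := mul_le_mul_of_nonneg_left (Real.rpow_le_rpow_of_exponent_le hT1 (by linarith))
          (by positivity)
  have hsplit : (Γ.card : ℝ) = ((Γ.filter fun ρ => |ρ.im| ≤ V).card : ℝ) +
      ((Γ.filter fun ρ => ¬ |ρ.im| ≤ V).card : ℝ) := by
    rw [← Nat.cast_add, Finset.card_filter_add_card_filter_not]
  rw [hsplit, add_mul]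
  exact add_le_add hlow' hhigh'

end BeurlingSystem

/-- **Zero-density estimate under the average Ramanujan condition** (Theorem 3.6).
If the system is `θ`-well-behaved and satisfies
`∑_{n_k ≤ x} χ(n_k, 1)^p ≪_ε x^{1+ε}` for some `p > 1`, then for every `ε > 0` and
`δ > 0` there exist `T₀` and a constant `C` (depending on `ε, p` and the system)
such that uniformly for `T ≥ T₀` and `α ≥ (θ+2)/3 + δ`:
`N(α, T) ≤ C T^{(1-α)(4α-2θ)/(2α²-3α+2-θ) + ε}`. -/
theorem beurling_zero_density_ramanujan
    (S : BeurlingSystem) (A θ K₀ : ℝ) (hWB : S.WellBehaved A θ K₀)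
    (ζ : ℂ → ℂ) (hζ : S.IsZeta θ ζ)
    (p : ℝ) (hp : 1 < p)
    (hRam : ∀ ε : ℝ, 0 < ε → ∃ Cε : ℝ, ∀ x : ℝ, 1 ≤ x →
      (∑ᶠ n ∈ {n : ℕ →₀ ℕ | S.val n ≤ x}, S.chi (S.val n) 1 ^ p) ≤ Cε * x ^ (1 + ε)) :
    ∀ ε δ : ℝ, 0 < ε → 0 < δ →
      ∃ T₀ C : ℝ, 0 < C ∧
        ∀ T α : ℝ, T₀ ≤ T → (θ + 2) / 3 + δ ≤ α →
          zeroCount ζ α T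
            ≤ C * T ^ ((1 - α) * (4 * α - 2 * θ) / (2 * α ^ 2 - 3 * α + 2 - θ) + ε) := by
  intro ε δ hε hδ
  obtain ⟨T₀, C, hT₀, hC, hmain⟩ := hζ.exists_card_zeros_le_rpow hWB hp hRam hε
  refine ⟨T₀, C, hC, fun T α hT hα => ?_⟩
  have hT0 : 0 < T := by linarith
  have hrhs : 0 ≤ C * T ^ ((1 - α) * (4 * α - 2 * θ) / (2 * α ^ 2 - 3 * α + 2 - θ) + ε) := by
    positivity
  have hre : ∀ ρ : ℂ, ζ ρ = 0 → ρ.re ≤ 1 := fun ρ hρ =>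
    not_lt.mp fun h1 => hζ.ne_zero hWB h1 hρ
  unfold zeroCount
  obtain hfin | hinf :=
    Set.finite_or_infinite {ρ : ℂ | ζ ρ = 0 ∧ ρ ≠ 1 ∧ α ≤ ρ.re ∧ |ρ.im| ≤ T}
  · obtain hα1 | hα1 := le_or_gt α 1
    · rw [Set.ncard_eq_toFinset_card _ hfin]
      refine hmain T α _ hT (by linarith) hα1 fun ρ hρ => ?_
      obtain ⟨h0, h1, h2, h3⟩ := hfin.mem_toFinset.mp hρ
      exact ⟨h0, h1, h2, hre ρ h0, h3⟩
    · have hempty : {ρ : ℂ | ζ ρ = 0 ∧ ρ ≠ 1 ∧ α ≤ ρ.re ∧ |ρ.im| ≤ T} = ∅ :=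
        Set.eq_empty_of_forall_notMem fun ρ hρ => by
          have := hre ρ hρ.1
          have := hρ.2.2.1
          linarith
      rw [hempty, Set.ncard_empty, Nat.cast_zero]
      exact hrhs
  · rw [hinf.ncard, Nat.cast_zero]
    exact hrhs
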